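/- arXiv:math/0503228 — 2 statements merged into one kernel-verified Lean document; each statement's English description precedes it below -/
import Mathlib

section
/- Let K and K' be any two fields and let Γ and Γ' be finite binary relations. Then the K-linearizations K(Γ) and K(Γ') are isomorphic as transformation-pairs over K if and only if the K'-linearizations K'(Γ) and K'(Γ') are isomorphic as transformation-pairs over K'; that is, linear equivalence of finite binary relations is independent of the ground field. -/
open Polynomial

namespace Towber

/-- A transformation-pair over `K`: two `K`-linear maps between
finite-dimensional `K`-vector spaces. -/
structure Pair (K : Type) [Field K] where
  E : Type
  V : Type
  [addE : AddCommGroup E]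
  [modE : Module K E]
  [finE : FiniteDimensional K E]
  [addV : AddCommGroup V]
  [modV : Module K V]
  [finV : FiniteDimensional K V]
  mu : E →ₗ[K] V
  nu : E →ₗ[K] V

attribute [instance] Pair.addE Pair.modE Pair.finE Pair.addV Pair.modV Pair.finV

variable (K : Type) [Field K]

/-- Isomorphism of transformation-pairs. -/
def Pair.Iso (τ σ : Pair K) : Prop :=
  ∃ (α : τ.E ≃ₗ[K] σ.E) (β : τ.V ≃ₗ[K] σ.V),
    (∀ x, σ.mu (α x) = β (τ.mu x)) ∧ (∀ x, σ.nu (α x) = β (τ.nu x))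

/-- Finite direct sum of transformation-pairs. -/
noncomputable def dSum (ι : Type) [Finite ι] (τ : ι → Pair K) : Pair K :=
  letI := Fintype.ofFinite ι
  { E := ∀ i, (τ i).E
    V := ∀ i, (τ i).V
    mu := LinearMap.pi fun i => (τ i).mu ∘ₗ LinearMap.proj i
    nu := LinearMap.pi fun i => (τ i).nu ∘ₗ LinearMap.proj i }

/-- Binary direct sum of transformation-pairs. -/
noncomputable def dSum2 (τ σ : Pair K) : Pair K where
  E := τ.E × σ.E
  V := τ.V × σ.V
  mu := τ.mu.prodMap σ.mu
  nu := τ.nu.prodMap σ.nu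

/-- A transformation-pair built from a pair of matrices. -/
noncomputable def ofMats {a b : ℕ} (M N : Matrix (Fin b) (Fin a) K) : Pair K where
  E := Fin a → K
  V := Fin b → K
  mu := Matrix.toLin' M
  nu := Matrix.toLin' N

/-- `^0T_n = [μ_n, I : K^n → K^n]`, where `μ_n` maps `f_i ↦ f_{i+1}`, `f_n ↦ 0`. -/
noncomputable def zT (n : ℕ) : Pair K :=
  ofMats K (Matrix.of fun j i : Fin n => if (i : ℕ) + 1 = (j : ℕ) then 1 else 0) 1

/-- `T^0_n = [I, μ_n : K^n → K^n]`. -/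
noncomputable def Tz (n : ℕ) : Pair K :=
  ofMats K 1 (Matrix.of fun j i : Fin n => if (i : ℕ) + 1 = (j : ℕ) then 1 else 0)

/-- `T_n = [κ_n, λ_n : K^n → K^{n+1}]`, `κ_n : f_i ↦ f_i`, `λ_n : f_i ↦ f_{i+1}`. -/
noncomputable def Tn (n : ℕ) : Pair K :=
  ofMats K (Matrix.of fun (j : Fin (n+1)) (i : Fin n) => if (j : ℕ) = (i : ℕ) then 1 else 0)
    (Matrix.of fun (j : Fin (n+1)) (i : Fin n) => if (j : ℕ) = (i : ℕ) + 1 then 1 else 0)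

/-- `^0T^0_n = [κ'_n, λ'_n : K^{n+1} → K^n]`. -/
noncomputable def zTz (n : ℕ) : Pair K :=
  ofMats K (Matrix.of fun (j : Fin n) (i : Fin (n+1)) => if (j : ℕ) = (i : ℕ) then 1 else 0)
    (Matrix.of fun (j : Fin n) (i : Fin (n+1)) => if (j : ℕ) + 1 = (i : ℕ) then 1 else 0)

/-- `S(F) = [·X, I : K[X]/(F) → K[X]/(F)]` for a nonzero polynomial `F`. -/
noncomputable def SP (F : Polynomial K) (hF : F ≠ 0) : Pair K :=
  letI : FiniteDimensional K (AdjoinRoot F) := (AdjoinRoot.powerBasis hF).finite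
  { E := AdjoinRoot F
    V := AdjoinRoot F
    mu := LinearMap.mulLeft K (AdjoinRoot.root F)
    nu := LinearMap.id }

/-- Membership in Kronecker's list `L(K)` (up to isomorphism). -/
def IsKron (σ : Pair K) : Prop :=
  (∃ n, 1 ≤ n ∧ Pair.Iso K σ (zT K n)) ∨
  (∃ n, 1 ≤ n ∧ Pair.Iso K σ (Tz K n)) ∨
  (∃ n, Pair.Iso K σ (Tn K n)) ∨
  (∃ n, Pair.Iso K σ (zTz K n)) ∨
  (∃ (p : Polynomial K) (n : ℕ), p.Monic ∧ Irreducible p ∧ p ≠ X ∧ 1 ≤ n ∧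
    ∃ h : p ^ n ≠ 0, Pair.Iso K σ (SP K (p ^ n) h))

/-- Being of type `S(p^n)` with `p` monic irreducible, `p ≠ X`, `n ≥ 1`. -/
def IsSType (σ : Pair K) : Prop :=
  ∃ (p : Polynomial K) (n : ℕ), p.Monic ∧ Irreducible p ∧ p ≠ X ∧ 1 ≤ n ∧
    ∃ h : p ^ n ≠ 0, Pair.Iso K σ (SP K (p ^ n) h)

/-- Membership in Weierstrass' (regular) part of Kronecker's list. -/
def IsKronReg (σ : Pair K) : Prop :=
  (∃ n, 1 ≤ n ∧ Pair.Iso K σ (zT K n)) ∨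
  (∃ n, 1 ≤ n ∧ Pair.Iso K σ (Tz K n)) ∨
  (∃ (p : Polynomial K) (n : ℕ), p.Monic ∧ Irreducible p ∧ p ≠ X ∧ 1 ≤ n ∧
    ∃ h : p ^ n ≠ 0, Pair.Iso K σ (SP K (p ^ n) h))

/-- A finite binary relation `(R, S)`. -/
structure BRel where
  S : Type
  R : S → S → Prop
  [fin : Finite S]

attribute [instance] BRel.fin

/-- The generating relation for left contraction:
`y ~ y'` whenever `∃ x, xRy ∧ xRy'`. -/
def BRel.lgen (Γ : BRel) : Γ.S → Γ.S → Prop := fun y y' => ∃ x, Γ.R x y ∧ Γ.R x y'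

/-- The generating relation for right contraction:
`x ~ x'` whenever `∃ y, xRy ∧ x'Ry`. -/
def BRel.rgen (Γ : BRel) : Γ.S → Γ.S → Prop := fun x x' => ∃ y, Γ.R x y ∧ Γ.R x' y

/-- Quotient of a binary relation by (the equivalence relation generated by) `r`:
two classes are related iff some representatives are related. -/
def BRel.quotBy (Γ : BRel) (r : Γ.S → Γ.S → Prop) : BRel where
  S := Quot r
  R := fun α β => ∃ a b, Quot.mk r a = α ∧ Quot.mk r b = β ∧ Γ.R a b

/-- Left contraction `C_l Γ`. -/
def BRel.Cl (Γ : BRel) : BRel := Γ.quotBy Γ.lgen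

/-- Right contraction `C_r Γ`. -/
def BRel.Cr (Γ : BRel) : BRel := Γ.quotBy Γ.rgen

/-- Graph-isomorphism of binary relations. -/
def BRel.Iso (Γ Δ : BRel) : Prop :=
  ∃ φ : Γ.S ≃ Δ.S, ∀ a b, Δ.R (φ a) (φ b) ↔ Γ.R a b

/-- `γ_{m,n}(Γ)`, the number of vertices of `C_l^m C_r^n Γ`. -/
noncomputable def BRel.gamma (Γ : BRel) (m n : ℕ) : ℕ :=
  Nat.card ((BRel.Cl^[m] (BRel.Cr^[n] Γ)).S)

/-- `Γ` has stabilized at `N`: for all `m, n ≥ N` the iterated contraction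
`C_l^m C_r^n Γ` is graph-isomorphic to `C_l^N C_r^N Γ`. -/
def BRel.StabAt (Γ : BRel) (N : ℕ) : Prop :=
  ∀ m, N ≤ m → ∀ n, N ≤ n →
    BRel.Iso (BRel.Cl^[m] (BRel.Cr^[n] Γ)) (BRel.Cl^[N] (BRel.Cr^[N] Γ))

/-- Number of edges of a binary relation. -/
noncomputable def BRel.edges (Γ : BRel) : ℕ :=
  Nat.card {p : Γ.S × Γ.S // Γ.R p.1 p.2}

/-- The `K`-linearization of a finite binary relation. -/
noncomputable def BRel.linz (Γ : BRel) : Pair K :=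
  letI := Fintype.ofFinite Γ.S
  letI := Classical.decEq Γ.S
  letI : DecidablePred (fun p : Γ.S × Γ.S => Γ.R p.1 p.2) := Classical.decPred _
  { E := {p : Γ.S × Γ.S // Γ.R p.1 p.2} → K
    V := Γ.S → K
    mu := Matrix.toLin' (Matrix.of fun (v : Γ.S) (e : {p : Γ.S × Γ.S // Γ.R p.1 p.2}) =>
      if e.1.1 = v then 1 else 0)
    nu := Matrix.toLin' (Matrix.of fun (v : Γ.S) (e : {p : Γ.S × Γ.S // Γ.R p.1 p.2}) =>
      if e.1.2 = v then 1 else 0) }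

/-- The disjoint union of the paths `L_{m i}` (on `m i` vertices) and the
cycles `C_{c j}` (on `c j` vertices). -/
def modelGraph (p q : ℕ) (m : Fin p → ℕ) (c : Fin q → ℕ) : BRel where
  S := (Σ i, Fin (m i)) ⊕ (Σ j, Fin (c j))
  R := fun x y =>
    (∃ (i : Fin p) (a b : Fin (m i)),
        x = Sum.inl ⟨i, a⟩ ∧ y = Sum.inl ⟨i, b⟩ ∧ (b : ℕ) = (a : ℕ) + 1) ∨
    (∃ (j : Fin q) (a b : Fin (c j)),
        x = Sum.inr ⟨j, a⟩ ∧ y = Sum.inr ⟨j, b⟩ ∧ (b : ℕ) = ((a : ℕ) + 1) % (c j))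

/-- A finite directed graph, possibly with parallel edges. -/
structure DiGraph where
  E : Type
  V : Type
  [finE : Finite E]
  [finV : Finite V]
  init : E → V
  term : E → V

attribute [instance] DiGraph.finE DiGraph.finV

/-- The parallelism relation on the edges of a directed graph. -/
def DiGraph.par (G : DiGraph) : G.E → G.E → Prop :=
  fun e e' => G.init e = G.init e' ∧ G.term e = G.term e'

/-- The reduced form of a directed graph: edges are parallelism classes. -/
def DiGraph.red (G : DiGraph) : DiGraph where
  E := Quot G.par
  V := G.V
  init := Quot.lift G.init fun _ _ h => h.1
  term := Quot.lift G.term fun _ _ h => h.2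

/-- The `K`-linearization of a finite directed graph. -/
noncomputable def DiGraph.linz (G : DiGraph) : Pair K :=
  letI := Fintype.ofFinite G.E
  letI := Fintype.ofFinite G.V
  letI := Classical.decEq G.V
  letI := Classical.decEq G.E
  { E := G.E → K
    V := G.V → K
    mu := Matrix.toLin' (Matrix.of fun (v : G.V) (e : G.E) => if G.init e = v then 1 else 0)
    nu := Matrix.toLin' (Matrix.of fun (v : G.V) (e : G.E) => if G.term e = v then 1 else 0) }

section LinearAlgebra

variable {k F E V W X E' V' W' X' : Type*} [Field k]
  [AddCommGroup E'] [Module k E'] [AddCommGroup V'] [Module k V']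
  [AddCommGroup W'] [Module k W'] [AddCommGroup X'] [Module k X']
  [AddCommGroup F] [Module k F] [AddCommGroup E] [Module k E] [AddCommGroup V] [Module k V]
  [AddCommGroup W] [Module k W] [AddCommGroup X] [Module k X]

/-- A linear map that kills `ker g` factors through `g`. -/
theorem exists_comp_eq_of_ker_le (g : F →ₗ[k] V) (g' : F →ₗ[k] V')
    (h : LinearMap.ker g ≤ LinearMap.ker g') : ∃ t : V →ₗ[k] V', ∀ x, t (g x) = g' x := by
  have hi : LinearMap.ker ((LinearMap.ker g).liftQ g le_rfl) = ⊥ :=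
    Submodule.ker_liftQ_eq_bot _ _ _ le_rfl
  obtain ⟨l, hl⟩ := LinearMap.exists_leftInverse_of_injective _ hi
  refine ⟨(LinearMap.ker g).liftQ g' h ∘ₗ l, fun x => ?_⟩
  have := LinearMap.congr_fun hl (Submodule.Quotient.mk x)
  simp only [LinearMap.comp_apply, Submodule.liftQ_apply, LinearMap.id_apply] at this
  simp [this]

/-- Two linear maps with the same kernel into spaces of the same dimension differ by an
isomorphism of the targets. -/
theorem exists_equiv_comp_eq [FiniteDimensional k V] [FiniteDimensional k V']
    (g : F →ₗ[k] V) (g' : F →ₗ[k] V') (h : LinearMap.ker g = LinearMap.ker g')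
    (hd : Module.finrank k V = Module.finrank k V') :
    ∃ β : V ≃ₗ[k] V', ∀ x, β (g x) = g' x := by
  let e : V ≃ₗ[k] V' := LinearEquiv.ofFinrankEq V V' hd
  let g₁ : F →ₗ[k] V' := e.toLinearMap ∘ₗ g
  have h₁ : LinearMap.ker g₁ = LinearMap.ker g' := by
    rw [← h]
    exact LinearMap.ker_comp_of_ker_eq_bot _ e.ker
  let f : LinearMap.range g₁ ≃ₗ[k] LinearMap.range g' :=
    g₁.quotKerEquivRange.symm ≪≫ₗ Submodule.quotEquivOfEq _ _ h₁ ≪≫ₗ g'.quotKerEquivRange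
  obtain ⟨b, hb⟩ := Submodule.exists_linearEquiv_restrict_eq f
  refine ⟨e ≪≫ₗ b, fun x => ?_⟩
  have hx := hb ⟨g₁ x, x, rfl⟩
  have : g₁.quotKerEquivRange.symm ⟨g₁ x, x, rfl⟩ = Submodule.Quotient.mk x := by
    rw [LinearEquiv.symm_apply_eq]
    rfl
  rw [LinearEquiv.trans_apply]
  change b (g₁ x) = _
  rw [← hx]
  simp only [f, LinearEquiv.trans_apply, this]
  rfl

/-- Two spaces of the same dimension lying under `X` and over `W`, with compatible structure
maps, are isomorphic under `X` and over `W`. -/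
theorem exists_equiv_over_under [FiniteDimensional k V] [FiniteDimensional k V']
    (n : X →ₗ[k] V) (n' : X →ₗ[k] V') (q : V →ₗ[k] W) (q' : V' →ₗ[k] W)
    (hn : LinearMap.ker n = LinearMap.ker n') (hq : LinearMap.range q = LinearMap.range q')
    (hc : ∀ x, q (n x) = q' (n' x)) (hd : Module.finrank k V = Module.finrank k V') :
    ∃ β : V ≃ₗ[k] V', (∀ x, β (n x) = n' x) ∧ ∀ v, q' (β v) = q v := by
  let Z : Submodule k X := LinearMap.ker (q ∘ₗ n)
  let i : Z →ₗ[k] LinearMap.ker q :=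
    (n ∘ₗ Z.subtype).codRestrict _ fun z => z.2
  let i' : Z →ₗ[k] LinearMap.ker q' :=
    (n' ∘ₗ Z.subtype).codRestrict _ fun z => (hc z).symm.trans z.2
  have hii : LinearMap.ker i = LinearMap.ker i' := by
    ext z
    have : n z = 0 ↔ n' z = 0 := SetLike.ext_iff.1 hn (z : X)
    rwa [LinearMap.mem_ker, LinearMap.mem_ker, Subtype.ext_iff, Subtype.ext_iff]
  have hdk : Module.finrank k (LinearMap.ker q) = Module.finrank k (LinearMap.ker q') := by
    have h₁ := q.finrank_range_add_finrank_ker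
    have h₂ := q'.finrank_range_add_finrank_ker
    rw [hq] at h₁
    omega
  obtain ⟨γ, hγ⟩ := exists_equiv_comp_eq i i' hii hdk
  obtain ⟨g, hg⟩ := exists_comp_eq_of_ker_le
    ((LinearMap.ker q).subtype.coprod n)
    (((LinearMap.ker q').subtype ∘ₗ γ.toLinearMap).coprod n') (by
      rintro ⟨a, x⟩ h
      simp only [LinearMap.mem_ker, LinearMap.coprod_apply, Submodule.subtype_apply,
        LinearMap.comp_apply, LinearEquiv.coe_coe] at h ⊢
      have hx : q (n x) = 0 := by
        have := congrArg q h
        simpa [LinearMap.mem_ker.1 a.2] using this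
      have ha : a = - i ⟨x, hx⟩ := by
        ext
        exact eq_neg_of_add_eq_zero_left h
      rw [ha, map_neg, hγ]
      exact neg_add_cancel _)
  have hg₁ : ∀ a (ha : q a = 0), g a = γ ⟨a, ha⟩ := fun a ha => by
    simpa using hg (⟨a, ha⟩, 0)
  have hg₂ : ∀ x, g (n x) = n' x := fun x => by simpa using hg (0, x)
  have hr : ∀ v, (q' ∘ₗ g - q) v ∈ LinearMap.range q' := fun v => by
    rw [LinearMap.sub_apply]
    exact sub_mem ⟨g v, rfl⟩ (hq ▸ ⟨v, rfl⟩)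
  obtain ⟨s, hs⟩ := q'.rangeRestrict.exists_rightInverse_of_surjective q'.range_rangeRestrict
  have hs' : ∀ w : LinearMap.range q', q' (s w) = w := fun w =>
    congrArg Subtype.val (LinearMap.congr_fun hs w)
  let b : V →ₗ[k] V' := g - s ∘ₗ (q' ∘ₗ g - q).codRestrict _ hr
  have hb : ∀ v, q' (g v) = q v → b v = g v := fun v hv => by
    have : (q' ∘ₗ g - q).codRestrict _ hr v = 0 := by
      ext
      simp [hv]
    rw [LinearMap.sub_apply, LinearMap.comp_apply, this, map_zero, sub_zero]
  have hbq : ∀ v, q' (b v) = q v := fun v => by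
    rw [LinearMap.sub_apply, LinearMap.comp_apply, map_sub, hs']
    simp
  have hinj : Function.Injective b := by
    rw [← LinearMap.ker_eq_bot, LinearMap.ker_eq_bot']
    intro v hv
    have hqv : q v = 0 := by rw [← hbq, hv, map_zero]
    have hgv : g v = 0 := by
      rw [← hb v, hv]
      rw [hqv, hg₁ v hqv]
      exact (γ ⟨v, hqv⟩).2
    rw [hg₁ v hqv] at hgv
    have : (⟨v, hqv⟩ : LinearMap.ker q) = 0 := by
      apply γ.injective
      ext
      simpa using hgv
    exact congrArg Subtype.val this
  refine ⟨b.linearEquivOfInjective hinj hd, fun x => ?_, hbq⟩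
  rw [LinearMap.linearEquivOfInjective_apply, hb, hg₂]
  rw [hg₂, hc]

/-- Isomorphism of pairs of parallel linear maps. -/
def PairIso (μ ν : E →ₗ[k] V) (μ' ν' : E' →ₗ[k] V') : Prop :=
  ∃ (α : E ≃ₗ[k] E') (β : V ≃ₗ[k] V'),
    (∀ x, μ' (α x) = β (μ x)) ∧ ∀ x, ν' (α x) = β (ν x)

/-- `(m, n)` is the quotient of the pair `(μ, ν)` by the subpair `(ker ν, μ (ker ν))`. -/
structure IsContraction (μ ν : E →ₗ[k] V) (m n : X →ₗ[k] W) (p : E →ₗ[k] X) (q : V →ₗ[k] W) :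
    Prop where
  surj_left : Function.Surjective p
  surj_right : Function.Surjective q
  comm_left : ∀ x, m (p x) = q (μ x)
  comm_right : ∀ x, n (p x) = q (ν x)
  ker_left : LinearMap.ker p = LinearMap.ker ν
  ker_right : LinearMap.ker q = (LinearMap.ker ν).map μ

/-- `(m, n)` is the restriction of the pair `(μ, ν)` to the subpair
`(μ⁻¹ (range ν), range ν)`. -/
structure IsRestriction (μ ν : E →ₗ[k] V) (m n : X →ₗ[k] W) (i : X →ₗ[k] E) (j : W →ₗ[k] V) :
    Prop where
  inj_left : Function.Injective i
  inj_right : Function.Injective j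
  comm_left : ∀ x, j (m x) = μ (i x)
  comm_right : ∀ x, j (n x) = ν (i x)
  range_left : LinearMap.range i = (LinearMap.range ν).comap μ
  range_right : LinearMap.range j = LinearMap.range ν

/-- An equivalence carrying `ker p` to `ker p'` descends along the surjections `p` and `p'`. -/
theorem exists_equiv_of_map_ker (p : E →ₗ[k] X) (p' : E' →ₗ[k] X') (hp : Function.Surjective p)
    (hp' : Function.Surjective p') (α : E ≃ₗ[k] E')
    (h : (LinearMap.ker p).map α.toLinearMap = LinearMap.ker p') :
    ∃ a : X ≃ₗ[k] X', ∀ x, a (p x) = p' (α x) := by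
  refine ⟨(p.quotKerEquivOfSurjective hp).symm ≪≫ₗ Submodule.Quotient.equiv _ _ α h ≪≫ₗ
    p'.quotKerEquivOfSurjective hp', fun x => ?_⟩
  simp [LinearMap.quotKerEquivOfSurjective_symm_apply]

/-- An equivalence carrying `range i` to `range i'` restricts along the injections `i` and
`i'`. -/
theorem exists_equiv_of_map_range (i : X →ₗ[k] E) (i' : X' →ₗ[k] E') (hi : Function.Injective i)
    (hi' : Function.Injective i') (α : E ≃ₗ[k] E')
    (h : (LinearMap.range i).map α.toLinearMap = LinearMap.range i') :
    ∃ a : X ≃ₗ[k] X', ∀ x, i' (a x) = α (i x) := by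
  let f := LinearEquiv.ofInjective i hi ≪≫ₗ α.submoduleMap _ ≪≫ₗ LinearEquiv.ofEq _ _ h
  refine ⟨f ≪≫ₗ (LinearEquiv.ofInjective i' hi').symm, fun x => ?_⟩
  have := LinearEquiv.apply_symm_apply (LinearEquiv.ofInjective i' hi') (f x)
  exact congrArg Subtype.val this

theorem map_ker_eq_of_comm {ν : E →ₗ[k] V} {ν' : E' →ₗ[k] V'} {α : E ≃ₗ[k] E'}
    {β : V ≃ₗ[k] V'} (h : ∀ x, ν' (α x) = β (ν x)) :
    (LinearMap.ker ν).map α.toLinearMap = LinearMap.ker ν' := by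
  ext y
  obtain ⟨x, rfl⟩ := α.surjective y
  simp [h]

theorem map_range_eq_of_comm {ν : E →ₗ[k] V} {ν' : E' →ₗ[k] V'} {α : E ≃ₗ[k] E'}
    {β : V ≃ₗ[k] V'} (h : ∀ x, ν' (α x) = β (ν x)) :
    (LinearMap.range ν).map β.toLinearMap = LinearMap.range ν' := by
  ext y
  constructor
  · rintro ⟨_, ⟨x, rfl⟩, rfl⟩
    exact ⟨α x, h x⟩
  · rintro ⟨x, rfl⟩
    obtain ⟨x, rfl⟩ := α.surjective x
    exact ⟨ν x, ⟨x, rfl⟩, (h x).symm⟩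

variable [FiniteDimensional k E'] [FiniteDimensional k V']
  [FiniteDimensional k E] [FiniteDimensional k V]

/-- A pair is determined up to isomorphism by its contraction and its dimensions. -/
theorem IsContraction.pairIso_iff {μ ν : E →ₗ[k] V} {m n : X →ₗ[k] W} {p : E →ₗ[k] X}
    {q : V →ₗ[k] W} {μ' ν' : E' →ₗ[k] V'} {m' n' : X' →ₗ[k] W'} {p' : E' →ₗ[k] X'}
    {q' : V' →ₗ[k] W'} (H : IsContraction μ ν m n p q) (H' : IsContraction μ' ν' m' n' p' q') :
    PairIso μ ν μ' ν' ↔ Module.finrank k E = Module.finrank k E' ∧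
      Module.finrank k V = Module.finrank k V' ∧ PairIso m n m' n' := by
  constructor
  · rintro ⟨α, β, h₁, h₂⟩
    have hk := map_ker_eq_of_comm h₂
    obtain ⟨a, ha⟩ := exists_equiv_of_map_ker p p' H.surj_left H'.surj_left α
      (by rw [H.ker_left, H'.ker_left, hk])
    obtain ⟨b, hb⟩ := exists_equiv_of_map_ker q q' H.surj_right H'.surj_right β (by
      rw [H.ker_right, H'.ker_right, ← hk, ← Submodule.map_comp, ← Submodule.map_comp]
      congr 1
      ext x
      exact (h₁ x).symm)
    refine ⟨α.finrank_eq, β.finrank_eq, a, b, fun x => ?_, fun x => ?_⟩ <;>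
      obtain ⟨x, rfl⟩ := H.surj_left x
    · rw [ha, H'.comm_left, H.comm_left, h₁, hb]
    · rw [ha, H'.comm_right, H.comm_right, h₂, hb]
  · rintro ⟨hE, hV, a, b, h₁, h₂⟩
    obtain ⟨r, hr⟩ := exists_comp_eq_of_ker_le p ν H.ker_left.le
    obtain ⟨r', hr'⟩ := exists_comp_eq_of_ker_le p' ν' H'.ker_left.le
    have hker : ∀ (x : X), r x = 0 ↔ x = 0 := fun x => by
      obtain ⟨x, rfl⟩ := H.surj_left x
      rw [hr]
      exact (SetLike.ext_iff.1 H.ker_left x).symm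
    have hker' : ∀ (x : X'), r' x = 0 ↔ x = 0 := fun x => by
      obtain ⟨x, rfl⟩ := H'.surj_left x
      rw [hr']
      exact (SetLike.ext_iff.1 H'.ker_left x).symm
    obtain ⟨β, hβ₁, hβ₂⟩ := exists_equiv_over_under r (r' ∘ₗ a.toLinearMap) (b.toLinearMap ∘ₗ q) q'
      (by ext x; simp [hker, hker'])
      (by
        rw [LinearMap.range_eq_top.2 H'.surj_right, LinearMap.range_eq_top]
        exact b.surjective.comp H.surj_right)
      (fun x => by
        obtain ⟨y, rfl⟩ := H.surj_left x
        obtain ⟨y', hy'⟩ := H'.surj_left (a (p y))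
        simp only [LinearMap.comp_apply, LinearEquiv.coe_coe, hr]
        rw [← H.comm_right, ← h₂, ← hy', hr', H'.comm_right]) hV
    simp only [LinearMap.comp_apply, LinearEquiv.coe_coe] at hβ₁ hβ₂
    obtain ⟨α, -, hα⟩ := exists_equiv_over_under (X := PUnit) (0 : PUnit →ₗ[k] E)
      (0 : PUnit →ₗ[k] E')
      ((a.toLinearMap ∘ₗ p).prod (β.toLinearMap ∘ₗ μ)) (p'.prod μ') (by simp)
      (by
        apply le_antisymm
        · rintro _ ⟨e, rfl⟩
          obtain ⟨e', he'⟩ := H'.surj_left (a (p e))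
          have hmem : β (μ e) - μ' e' ∈ LinearMap.ker q' := by
            rw [LinearMap.mem_ker, map_sub, hβ₂, ← H.comm_left, ← h₁, ← he', H'.comm_left,
              sub_self]
          rw [H'.ker_right] at hmem
          obtain ⟨d, hd, hde⟩ := hmem
          rw [SetLike.mem_coe, ← H'.ker_left, LinearMap.mem_ker] at hd
          refine ⟨e' + d, Prod.ext ?_ ?_⟩
          · simp [hd, he']
          · simp [hde]
        · rintro _ ⟨e', rfl⟩
          obtain ⟨e, he⟩ := H.surj_left (a.symm (p' e'))
          have hmem : β.symm (μ' e') - μ e ∈ LinearMap.ker q := by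
            rw [LinearMap.mem_ker, map_sub, ← b.injective.eq_iff, map_zero, map_sub, ← hβ₂,
              β.apply_symm_apply, ← H.comm_left, ← h₁, he, a.apply_symm_apply, H'.comm_left,
              sub_self]
          rw [H.ker_right] at hmem
          obtain ⟨d, hd, hde⟩ := hmem
          rw [SetLike.mem_coe, ← H.ker_left, LinearMap.mem_ker] at hd
          refine ⟨e + d, Prod.ext ?_ ?_⟩
          · simp [hd, he]
          · simp [hde])
      (by simp) hE
    have hα₁ : ∀ x, p' (α x) = a (p x) := fun x => congrArg Prod.fst (hα x)
    refine ⟨α, β, fun x => congrArg Prod.snd (hα x), fun x => ?_⟩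
    rw [← hr', hα₁, ← hr, hβ₁]

/-- A pair is determined up to isomorphism by its restriction and its dimensions. -/
theorem IsRestriction.pairIso_iff {μ ν : E →ₗ[k] V} {m n : X →ₗ[k] W} {i : X →ₗ[k] E}
    {j : W →ₗ[k] V} {μ' ν' : E' →ₗ[k] V'} {m' n' : X' →ₗ[k] W'} {i' : X' →ₗ[k] E'}
    {j' : W' →ₗ[k] V'} (H : IsRestriction μ ν m n i j) (H' : IsRestriction μ' ν' m' n' i' j') :
    PairIso μ ν μ' ν' ↔ Module.finrank k E = Module.finrank k E' ∧
      Module.finrank k V = Module.finrank k V' ∧ PairIso m n m' n' := by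
  constructor
  · rintro ⟨α, β, h₁, h₂⟩
    have hk := map_range_eq_of_comm h₂
    obtain ⟨a, ha⟩ := exists_equiv_of_map_range i i' H.inj_left H'.inj_left α (by
      rw [H.range_left, H'.range_left, ← hk]
      ext y
      obtain ⟨x, rfl⟩ := α.surjective y
      simp [h₁])
    obtain ⟨b, hb⟩ := exists_equiv_of_map_range j j' H.inj_right H'.inj_right β
      (by rw [H.range_right, H'.range_right, hk])
    refine ⟨α.finrank_eq, β.finrank_eq, a, b, fun x => ?_, fun x => ?_⟩ <;>
      apply H'.inj_right
    · rw [H'.comm_left, ha, h₁, hb, H.comm_left]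
    · rw [H'.comm_right, ha, h₂, hb, H.comm_right]
  · rintro ⟨hE, hV, a, b, h₁, h₂⟩
    obtain ⟨r, hr⟩ : ∃ r : E →ₗ[k] W, ∀ x, j (r x) = ν x :=
      ⟨(LinearEquiv.ofInjective j H.inj_right).symm.toLinearMap ∘ₗ
        ν.codRestrict _ (fun x => H.range_right ▸ ⟨x, rfl⟩), fun x => congrArg Subtype.val
          ((LinearEquiv.ofInjective j H.inj_right).apply_symm_apply _)⟩
    obtain ⟨r', hr'⟩ : ∃ r : E' →ₗ[k] W', ∀ x, j' (r x) = ν' x :=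
      ⟨(LinearEquiv.ofInjective j' H'.inj_right).symm.toLinearMap ∘ₗ
        ν'.codRestrict _ (fun x => H'.range_right ▸ ⟨x, rfl⟩), fun x => congrArg Subtype.val
          ((LinearEquiv.ofInjective j' H'.inj_right).apply_symm_apply _)⟩
    have hsurj : Function.Surjective r := fun w => by
      obtain ⟨x, hx⟩ : j w ∈ LinearMap.range ν := H.range_right ▸ ⟨w, rfl⟩
      exact ⟨x, H.inj_right ((hr x).trans hx)⟩
    have hsurj' : Function.Surjective r' := fun w => by
      obtain ⟨x, hx⟩ : j' w ∈ LinearMap.range ν' := H'.range_right ▸ ⟨w, rfl⟩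
      exact ⟨x, H'.inj_right ((hr' x).trans hx)⟩
    obtain ⟨α, hα₁, hα₂⟩ := exists_equiv_over_under i (i' ∘ₗ a.toLinearMap) (b.toLinearMap ∘ₗ r) r'
      (by
        rw [LinearMap.ker_eq_bot.2 H.inj_left, eq_comm, LinearMap.ker_eq_bot]
        exact H'.inj_left.comp a.injective)
      (by
        rw [LinearMap.range_eq_top.2 hsurj', LinearMap.range_eq_top]
        exact b.surjective.comp hsurj)
      (fun x => by
        have e₁ : r (i x) = n x := H.inj_right (by rw [hr, H.comm_right])
        have e₂ : r' (i' (a x)) = n' (a x) := H'.inj_right (by rw [hr', H'.comm_right])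
        simp [e₁, e₂, h₂]) hE
    simp only [LinearMap.comp_apply, LinearEquiv.coe_coe] at hα₁ hα₂
    obtain ⟨β, hβ⟩ := exists_equiv_comp_eq (μ.coprod j)
      ((μ' ∘ₗ α.toLinearMap).coprod (j' ∘ₗ b.toLinearMap)) (by
        have key : ∀ x w, μ (i x) + j w = 0 ↔ μ' (i' (a x)) + j' (b w) = 0 := fun x w => by
          rw [← H.comm_left, ← H'.comm_left, ← map_add, ← map_add, h₁, ← map_add,
            map_eq_zero_iff _ H.inj_right, map_eq_zero_iff _ H'.inj_right, b.map_eq_zero_iff]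
        ext ⟨e, w⟩
        simp only [LinearMap.mem_ker, LinearMap.coprod_apply, LinearMap.comp_apply,
          LinearEquiv.coe_coe]
        constructor
        · intro h
          obtain ⟨x, rfl⟩ : e ∈ LinearMap.range i := by
            rw [H.range_left, Submodule.mem_comap, ← H.range_right, eq_neg_of_add_eq_zero_left h]
            exact neg_mem ⟨w, rfl⟩
          rwa [hα₁, ← key]
        · intro h
          obtain ⟨x, hx⟩ : α e ∈ LinearMap.range i' := by
            rw [H'.range_left, Submodule.mem_comap, ← H'.range_right, eq_neg_of_add_eq_zero_left h]
            exact neg_mem ⟨b w, rfl⟩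
          obtain ⟨x, rfl⟩ := a.surjective x
          rw [← hα₁, α.injective.eq_iff] at hx
          subst hx
          rwa [hα₁, ← key] at h) hV
    have hβ₁ : ∀ x, β (μ x) = μ' (α x) := fun x => by simpa using hβ (x, 0)
    have hβ₂ : ∀ w, β (j w) = j' (b w) := fun w => by simpa using hβ (0, w)
    exact ⟨α, β, fun x => (hβ₁ x).symm, fun x => by rw [← hr, hβ₂, ← hα₂, hr']⟩

end LinearAlgebra

section Graphs

variable {k : Type*} [Field k]

theorem ker_lmapDomain_quot {V : Type*} (r : V → V → Prop) :
    LinearMap.ker (Finsupp.lmapDomain k k (Quot.mk r)) =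
      Submodule.span k {x | ∃ a b, r a b ∧ Finsupp.single a 1 - Finsupp.single b 1 = x} := by
  set D := Submodule.span k {x : V →₀ k | ∃ a b, r a b ∧
    Finsupp.single a 1 - Finsupp.single b 1 = x} with hD
  apply le_antisymm
  · let f : Quot r → (V →₀ k) ⧸ D := Quot.lift (fun v => D.mkQ (Finsupp.single v 1))
      fun a b h => (Submodule.Quotient.eq D).2 (Submodule.subset_span ⟨a, b, h, rfl⟩)
    have hf : Finsupp.linearCombination k f ∘ₗ Finsupp.lmapDomain k k (Quot.mk r) = D.mkQ := by
      ext v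
      simp [f]
    intro x hx
    rw [← Submodule.ker_mkQ D, ← hf, LinearMap.mem_ker, LinearMap.comp_apply,
      LinearMap.mem_ker.1 hx, map_zero]
  · rw [hD, Submodule.span_le]
    rintro _ ⟨a, b, h, rfl⟩
    simp [Finsupp.mapDomain_sub, Quot.sound h]

theorem lmapDomain_injective {V W : Type*} {f : V → W} (hf : Function.Injective f) :
    Function.Injective (Finsupp.lmapDomain k k f) :=
  Finsupp.mapDomain_injective hf

theorem lmapDomain_surjective {V W : Type*} {f : V → W} (hf : Function.Surjective f) :
    Function.Surjective (Finsupp.lmapDomain k k f) :=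
  Finsupp.mapDomain_surjective hf

theorem lmapDomain_comm {U V W V' : Type*} {f : V → W} {g : U → V} {f' : V' → W} {g' : U → V'}
    (h : ∀ u, f (g u) = f' (g' u)) (x : U →₀ k) :
    Finsupp.lmapDomain k k f (Finsupp.lmapDomain k k g x) =
      Finsupp.lmapDomain k k f' (Finsupp.lmapDomain k k g' x) := by
  simp only [Finsupp.lmapDomain_apply, ← Finsupp.mapDomain_comp]
  exact congrArg (Finsupp.mapDomain · x) (funext h)

/-- The linear extensions of the two structure maps of `G` and of `G'` are isomorphic pairs. -/
def DiGraph.LinIso (k : Type*) [Field k] (G G' : DiGraph) : Prop :=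
  PairIso (Finsupp.lmapDomain k k G.init) (Finsupp.lmapDomain k k G.term)
    (Finsupp.lmapDomain k k G'.init) (Finsupp.lmapDomain k k G'.term)

/-- The digraph with all arrows reversed. -/
def DiGraph.rev (G : DiGraph) : DiGraph where
  E := G.E
  V := G.V
  init := G.term
  term := G.init

theorem DiGraph.LinIso.rev {G G' : DiGraph} (h : G.LinIso k G') : G.rev.LinIso k G'.rev := by
  obtain ⟨α, β, h₁, h₂⟩ := h
  exact ⟨α, β, h₂, h₁⟩

/-- Contraction of a digraph: edges with the same end are identified, together with their
origins. -/
def DiGraph.contr (G : DiGraph) : DiGraph where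
  E := Quot fun e e' : G.E => G.term e = G.term e'
  V := Quot fun v v' => ∃ e e', G.term e = G.term e' ∧ G.init e = v ∧ G.init e' = v'
  init := Quot.map G.init fun e e' h => ⟨e, e', h, rfl, rfl⟩
  term := Quot.lift (fun e => Quot.mk _ (G.term e)) fun _ _ h => congrArg _ h

/-- The projection of edges onto the contraction. -/
def DiGraph.contrE (G : DiGraph) : G.E → G.contr.E := Quot.mk _

/-- The projection of vertices onto the contraction. -/
def DiGraph.contrV (G : DiGraph) : G.V → G.contr.V := Quot.mk _

theorem DiGraph.ker_contrE (G : DiGraph) :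
    LinearMap.ker (Finsupp.lmapDomain k k G.contrE) =
      LinearMap.ker (Finsupp.lmapDomain k k G.term) := by
  let f : G.contr.E → G.V := Quot.lift G.term fun _ _ h => h
  have hf : Function.Injective f := by
    rintro ⟨a⟩ ⟨b⟩ h
    exact Quot.sound h
  have : Finsupp.lmapDomain k k G.term = Finsupp.lmapDomain k k f ∘ₗ
      Finsupp.lmapDomain k k G.contrE := by
    rw [← Finsupp.lmapDomain_comp]
    rfl
  rw [this, LinearMap.ker_comp_of_ker_eq_bot _
    (LinearMap.ker_eq_bot.2 (lmapDomain_injective hf))]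

theorem DiGraph.isContraction (G : DiGraph) :
    IsContraction (Finsupp.lmapDomain k k G.init) (Finsupp.lmapDomain k k G.term)
      (Finsupp.lmapDomain k k G.contr.init) (Finsupp.lmapDomain k k G.contr.term)
      (Finsupp.lmapDomain k k G.contrE) (Finsupp.lmapDomain k k G.contrV) where
  surj_left := lmapDomain_surjective Quot.mk_surjective
  surj_right := lmapDomain_surjective Quot.mk_surjective
  comm_left x := lmapDomain_comm (by intro; rfl) x
  comm_right x := lmapDomain_comm (by intro; rfl) x
  ker_left := G.ker_contrE
  ker_right := by
    have hE : LinearMap.ker (Finsupp.lmapDomain k k G.contrE) = _ := ker_lmapDomain_quot _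
    have hV : LinearMap.ker (Finsupp.lmapDomain k k G.contrV) = _ := ker_lmapDomain_quot _
    rw [← G.ker_contrE, hE, hV, Submodule.map_span]
    congr 1
    ext x
    constructor
    · rintro ⟨_, _, ⟨e, e', h, rfl, rfl⟩, rfl⟩
      exact ⟨_, ⟨e, e', h, rfl⟩, by simp [Finsupp.mapDomain_sub]⟩
    · rintro ⟨_, ⟨e, e', h, rfl⟩, rfl⟩
      exact ⟨_, _, ⟨e, e', h, rfl, rfl⟩, by simp [Finsupp.mapDomain_sub]⟩

theorem DiGraph.linIso_iff_contr (G G' : DiGraph) :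
    G.LinIso k G' ↔ Nat.card G.E = Nat.card G'.E ∧ Nat.card G.V = Nat.card G'.V ∧
      G.contr.LinIso k G'.contr := by
  rw [LinIso, G.isContraction.pairIso_iff G'.isContraction]
  simp only [Module.finrank_eq_nat_card_basis (Finsupp.basisSingleOne)]
  rfl

/-- The part of a digraph spanned by the ends of edges. -/
def DiGraph.restr (G : DiGraph) : DiGraph where
  E := {e // G.init e ∈ Set.range G.term}
  V := Set.range G.term
  init e := ⟨G.init e, e.2⟩
  term e := ⟨G.term e, e, rfl⟩

/-- The inclusion of edges of the restriction. -/
def DiGraph.restrE (G : DiGraph) : G.restr.E → G.E := Subtype.val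

/-- The inclusion of vertices of the restriction. -/
def DiGraph.restrV (G : DiGraph) : G.restr.V → G.V := Subtype.val

theorem DiGraph.range_restrE (G : DiGraph) :
    Set.range G.restrE = {e | G.init e ∈ Set.range G.term} :=
  Subtype.range_coe

theorem DiGraph.range_restrV (G : DiGraph) : Set.range G.restrV = Set.range G.term :=
  Subtype.range_coe

theorem range_lmapDomain {V W : Type*} (f : V → W) :
    LinearMap.range (Finsupp.lmapDomain k k f) = Finsupp.supported k k (Set.range f) := by
  rw [← Set.image_univ, ← Finsupp.lmapDomain_supported, Finsupp.supported_univ,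
    LinearMap.range_eq_map]

theorem DiGraph.isRestriction (G : DiGraph) (h : Function.Injective G.init) :
    IsRestriction (Finsupp.lmapDomain k k G.init) (Finsupp.lmapDomain k k G.term)
      (Finsupp.lmapDomain k k G.restr.init) (Finsupp.lmapDomain k k G.restr.term)
      (Finsupp.lmapDomain k k G.restrE) (Finsupp.lmapDomain k k G.restrV) where
  inj_left := lmapDomain_injective Subtype.val_injective
  inj_right := lmapDomain_injective Subtype.val_injective
  comm_left x := lmapDomain_comm (by intro; rfl) x
  comm_right x := lmapDomain_comm (by intro; rfl) x
  range_left := by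
    classical
    rw [range_lmapDomain, range_lmapDomain, G.range_restrE]
    ext x
    rw [Submodule.mem_comap, Finsupp.mem_supported, Finsupp.mem_supported,
      Finsupp.lmapDomain_apply, Finsupp.mapDomain_support_of_injective h]
    simp [Set.subset_def]
  range_right := by
    rw [range_lmapDomain, range_lmapDomain, G.range_restrV]

theorem DiGraph.linIso_iff_restr (G G' : DiGraph) (h : Function.Injective G.init)
    (h' : Function.Injective G'.init) :
    G.LinIso k G' ↔ Nat.card G.E = Nat.card G'.E ∧ Nat.card G.V = Nat.card G'.V ∧
      G.restr.LinIso k G'.restr := by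
  rw [LinIso, (G.isRestriction h).pairIso_iff (G'.isRestriction h')]
  simp only [Module.finrank_eq_nat_card_basis (Finsupp.basisSingleOne)]
  rfl

end Graphs

section Permutations

theorem quot_mk_eq_iff_sameCycle {V : Type*} (τ : Equiv.Perm V) (a b : V) :
    Quot.mk (fun x y => y = τ x) a = Quot.mk (fun x y => y = τ x) b ↔ τ.SameCycle a b := by
  constructor
  · intro h
    let f : Quot (fun x y => y = τ x) → Quotient (Equiv.Perm.SameCycle.setoid τ) :=
      Quot.lift (Quotient.mk _) fun x y h => Quotient.sound ⟨1, by simp [h]⟩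
    exact Quotient.exact (congrArg f h)
  · rintro ⟨i, rfl⟩
    have h₁ (v : V) : Quot.mk (fun x y => y = τ x) (τ v) = Quot.mk _ v :=
      (Quot.sound (r := fun x y => y = τ x) rfl).symm
    induction i using Int.induction_on with
    | zero => rfl
    | succ n ih => rw [add_comm, zpow_add, zpow_one, Equiv.Perm.mul_apply, h₁, ih]
    | pred n ih =>
      rw [ih, ← h₁ ((τ ^ (-(n : ℤ) - 1)) a), ← Equiv.Perm.mul_apply, ← zpow_one_add]
      simp

theorem natCard_sameCycle {V : Type*} [Finite V] (τ : Equiv.Perm V) (a : V) :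
    Nat.card {v // τ.SameCycle a v} = Function.minimalPeriod τ a := by
  cases nonempty_fintype V
  classical
  have := MulAction.minimalPeriod_eq_card (a := τ) (b := a)
  rw [← Nat.card_eq_fintype_card] at this
  refine Eq.trans (Nat.card_congr (Equiv.subtypeEquivRight fun v => ?_)) this.symm
  rw [MulAction.mem_orbit_iff]
  constructor
  · rintro ⟨i, rfl⟩
    exact ⟨⟨τ ^ i, i, rfl⟩, rfl⟩
  · rintro ⟨⟨_, i, rfl⟩, h⟩
    exact ⟨i, h⟩

theorem minimalPeriod_eq_of_sameCycle {V : Type*} [Finite V] {τ : Equiv.Perm V} {a b : V}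
    (h : τ.SameCycle a b) : Function.minimalPeriod τ a = Function.minimalPeriod τ b := by
  rw [← natCard_sameCycle, ← natCard_sameCycle]
  exact Nat.card_congr (Equiv.subtypeEquivRight fun v => ⟨h.symm.trans, h.trans⟩)

theorem minimalPeriod_perm_pos {V : Type*} [Finite V] (τ : Equiv.Perm V) (a : V) :
    0 < Function.minimalPeriod τ a := by
  rw [← natCard_sameCycle]
  have : Nonempty {v // τ.SameCycle a v} := ⟨⟨a, .refl τ a⟩⟩
  exact Nat.card_pos

/-- The number of orbits of a permutation. -/
theorem natCard_quot_perm {V : Type*} [Fintype V] (τ : Equiv.Perm V) :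
    (Nat.card (Quot fun x y => y = τ x) : ℚ) = ∑ v, (1 / Function.minimalPeriod τ v : ℚ) := by
  classical
  have : Fintype (Quot fun x y => y = τ x) := Fintype.ofFinite _
  rw [← Finset.sum_fiberwise Finset.univ (Quot.mk fun x y => y = τ x), Nat.card_eq_fintype_card,
    Fintype.card_eq_sum_ones, Nat.cast_sum]
  refine Finset.sum_congr rfl fun q _ => ?_
  induction q using Quot.ind with | _ a
  have hp := minimalPeriod_perm_pos τ a
  rw [Finset.sum_congr rfl (g := fun _ => (1 / Function.minimalPeriod τ a : ℚ)) fun v hv => by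
    rw [minimalPeriod_eq_of_sameCycle
      ((quot_mk_eq_iff_sameCycle τ v a).1 (Finset.mem_filter.1 hv).2)]]
  have hc : (Finset.univ.filter fun v => Quot.mk (fun x y => y = τ x) v = Quot.mk _ a).card =
      Function.minimalPeriod τ a := by
    rw [← natCard_sameCycle, ← Nat.subtype_card _ (p := fun v => τ.SameCycle a v)]
    intro v
    simp [quot_mk_eq_iff_sameCycle, Equiv.Perm.sameCycle_comm]
  rw [Finset.sum_const, hc, nsmul_eq_mul]
  field_simp
  simp

/-- Nonsingularity of the matrix of greatest common divisors. -/
theorem eq_zero_of_sum_mul_gcd_eq_zero {N : ℕ} {x : ℕ → ℚ}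
    (h : ∀ n, 1 ≤ n → ∑ d ∈ Finset.Icc 1 N, x d * (n.gcd d : ℚ) = 0) :
    ∀ d ∈ Finset.Icc 1 N, x d = 0 := by
  set S : ℕ → ℚ := fun e => ∑ d ∈ Finset.Icc 1 N with e ∣ d, x d with hS
  have h₁ (n : ℕ) (hn : 1 ≤ n) : ∑ e ∈ n.divisors, (e.totient : ℚ) * S e = 0 := by
    rw [← h n hn]
    simp only [hS, Finset.sum_filter, Finset.mul_sum]
    rw [Finset.sum_comm]
    refine Finset.sum_congr rfl fun d hd => ?_
    have hd' : d ≠ 0 := by have := (Finset.mem_Icc.1 hd).1; omega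
    have hg : n.gcd d = ∑ e ∈ n.divisors with e ∣ d, e.totient := by
      rw [← Nat.sum_totient (n.gcd d)]
      refine Finset.sum_congr ?_ fun _ _ => rfl
      ext e
      simp [Nat.dvd_gcd_iff, hd']
      omega
    rw [hg, Finset.sum_filter, Nat.cast_sum, Finset.mul_sum]
    refine Finset.sum_congr rfl fun e _ => ?_
    split_ifs <;> simp [mul_comm]
  have h₂ (n : ℕ) (hn : 1 ≤ n) : S n = 0 := by
    induction n using Nat.strong_induction_on with | _ n ih
    have := h₁ n hn
    rw [← Nat.insert_self_properDivisors (by omega), Finset.sum_insert (by simp),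
      Finset.sum_eq_zero (s := n.properDivisors), add_zero] at this
    · have hp : n.totient ≠ 0 := (Nat.totient_pos.2 hn).ne'
      simpa [hp] using this
    · intro e he
      rw [ih e (Nat.mem_properDivisors.1 he).2
        (Nat.pos_of_mem_properDivisors he), mul_zero]
  intro d hd
  induction hm : N - d using Nat.strong_induction_on generalizing d with | _ m ih
  have hd' := Finset.mem_Icc.1 hd
  rw [← h₂ d hd'.1, hS]
  refine (Finset.sum_eq_single_of_mem d (by simp [hd']) fun e he hed => ?_).symm
  obtain ⟨he, hde⟩ := Finset.mem_filter.1 he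
  have he' := Finset.mem_Icc.1 he
  have := Nat.le_of_dvd he'.1 hde
  exact ih (N - e) (by omega) e he rfl

/-- Permutations all of whose powers have equally many orbits have equally many points of
each period. -/
theorem card_minimalPeriod_eq {V : Type*} [Fintype V] (σ σ' : Equiv.Perm V)
    (h : ∀ n,
      Nat.card (Quot fun x y => y = (σ ^ n) x) = Nat.card (Quot fun x y => y = (σ' ^ n) x))
    (d : ℕ) :
    (Finset.univ.filter fun v => Function.minimalPeriod σ v = d).card =
      (Finset.univ.filter fun v => Function.minimalPeriod σ' v = d).card := by
  classical
  set N := Fintype.card V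
  have hmem (τ : Equiv.Perm V) (v : V) : Function.minimalPeriod τ v ∈ Finset.Icc 1 N := by
    rw [Finset.mem_Icc, ← natCard_sameCycle]
    refine ⟨?_, ?_⟩
    · rw [natCard_sameCycle]
      exact minimalPeriod_perm_pos τ v
    · exact (Finite.card_subtype_le _).trans_eq Nat.card_eq_fintype_card
  set b : Equiv.Perm V → ℕ → ℕ := fun τ d =>
    (Finset.univ.filter fun v => Function.minimalPeriod τ v = d).card with hb
  have key (τ : Equiv.Perm V) (n : ℕ) (hn : 1 ≤ n) :
      (Nat.card (Quot fun x y => y = (τ ^ n) x) : ℚ) =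
        ∑ d ∈ Finset.Icc 1 N, (b τ d / d : ℚ) * (n.gcd d : ℚ) := by
    rw [natCard_quot_perm, ← Finset.sum_fiberwise_of_maps_to (t := Finset.Icc 1 N)
      (g := fun v => Function.minimalPeriod τ v) fun v _ => hmem τ v]
    refine Finset.sum_congr rfl fun d hd => ?_
    have hd' : 0 < d := (Finset.mem_Icc.1 hd).1
    rw [Finset.sum_congr rfl (g := fun _ => ((n.gcd d : ℚ) / d)) fun v hv => ?_,
      Finset.sum_const, nsmul_eq_mul]
    · ring
    · rw [Equiv.Perm.coe_pow, Function.minimalPeriod_iterate_eq_div_gcd (by omega),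
        (Finset.mem_filter.1 hv).2, Nat.cast_div (Nat.gcd_dvd_left _ _), Nat.gcd_comm, one_div_div]
      have := Nat.gcd_pos_of_pos_left n hd'
      positivity
  by_cases hd : d ∈ Finset.Icc 1 N
  · have := eq_zero_of_sum_mul_gcd_eq_zero (N := N)
      (x := fun d => (b σ d / d : ℚ) - (b σ' d / d : ℚ)) (fun n hn => by
        simp only [sub_mul, Finset.sum_sub_distrib]
        rw [← key σ n hn, ← key σ' n hn, h, sub_self]) d hd
    have hd' : (d : ℚ) ≠ 0 := by
      have := (Finset.mem_Icc.1 hd).1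
      positivity
    have h₂ : (b σ d : ℚ) = b σ' d := by
      field_simp at this
      linarith
    exact_mod_cast h₂
  · rw [Finset.card_eq_zero.2, Finset.card_eq_zero.2]
    all_goals
      refine Finset.filter_eq_empty_iff.2 fun v _ hv => hd (hv ▸ hmem _ v)

theorem mem_support_iff_one_lt_minimalPeriod {V : Type*} [Fintype V] [DecidableEq V]
    (σ : Equiv.Perm V) (v : V) : v ∈ σ.support ↔ 2 ≤ Function.minimalPeriod σ v := by
  have := minimalPeriod_perm_pos σ v
  have h : Function.minimalPeriod σ v = 1 ↔ σ v = v := Function.minimalPeriod_eq_one_iff_isFixedPt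
  rw [Equiv.Perm.mem_support, Ne, ← h]
  omega

theorem card_support_cycleOf {V : Type*} [Fintype V] [DecidableEq V] (σ : Equiv.Perm V) {v : V}
    (hv : v ∈ σ.support) : (σ.cycleOf v).support.card = Function.minimalPeriod σ v := by
  rw [← natCard_sameCycle, ← Nat.subtype_card _ (p := fun w => σ.SameCycle v w)]
  intro w
  rw [Equiv.Perm.mem_support_cycleOf_iff]
  exact and_iff_left hv

theorem count_cycleType_mul {V : Type*} [Fintype V] [DecidableEq V] (σ : Equiv.Perm V) {d : ℕ}
    (hd : 2 ≤ d) :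
    σ.cycleType.count d * d =
      (Finset.univ.filter fun v => Function.minimalPeriod σ v = d).card := by
  have hc : σ.cycleType.count d =
      (σ.cycleFactorsFinset.filter fun c => c.support.card = d).card := by
    rw [Equiv.Perm.cycleType, Multiset.count_map, Finset.card_def, Finset.filter_val]
    simp [eq_comm]
  have hs {v : V} (h : Function.minimalPeriod σ v = d) : v ∈ σ.support :=
    (mem_support_iff_one_lt_minimalPeriod σ v).2 (h ▸ hd)
  rw [hc, Finset.card_eq_sum_card_fiberwise (f := fun v => σ.cycleOf v)
    (t := σ.cycleFactorsFinset.filter fun c => c.support.card = d), Finset.sum_const_nat]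
  · intro c hc
    obtain ⟨hcf, rfl⟩ := Finset.mem_filter.1 hc
    congr 1
    ext v
    simp only [Finset.mem_filter, Finset.mem_univ, true_and]
    constructor
    · rintro ⟨h, rfl⟩
      rw [Equiv.Perm.mem_support_cycleOf_iff]
      exact ⟨.refl _ _, hs h⟩
    · intro h
      have hv : v ∈ σ.support := Equiv.Perm.mem_cycleFactorsFinset_support_le hcf h
      have h' := Equiv.Perm.cycle_is_cycleOf h hcf
      exact ⟨by rw [h', card_support_cycleOf σ hv], h'.symm⟩
  · intro v hv
    have hv : Function.minimalPeriod σ v = d := by simpa using hv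
    simp [Equiv.Perm.cycleOf_mem_cycleFactorsFinset_iff, hs hv, card_support_cycleOf σ (hs hv), hv,
      -Equiv.Perm.mem_support]

theorem isConj_of_natCard_quot {V : Type*} [Fintype V] (σ σ' : Equiv.Perm V)
    (h : ∀ n,
      Nat.card (Quot fun x y => y = (σ ^ n) x) = Nat.card (Quot fun x y => y = (σ' ^ n) x)) :
    IsConj σ σ' := by
  classical
  rw [Equiv.Perm.isConj_iff_cycleType_eq]
  ext d
  by_cases hd : 2 ≤ d
  · refine Nat.eq_of_mul_eq_mul_right (by omega : 0 < d) ?_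
    rw [count_cycleType_mul σ hd, count_cycleType_mul σ' hd, card_minimalPeriod_eq σ σ' h]
  · rw [Multiset.count_eq_zero_of_notMem, Multiset.count_eq_zero_of_notMem]
    all_goals exact fun h => hd (Equiv.Perm.two_le_of_mem_cycleType h)

end Permutations

section Bijective

variable {k : Type*} [Field k]

theorem ker_lmapDomain_quot_fun {V : Type*} (f : V → V) :
    LinearMap.ker (Finsupp.lmapDomain k k (Quot.mk fun x y => y = f x)) =
      LinearMap.range (LinearMap.id - Finsupp.lmapDomain k k f) := by
  rw [ker_lmapDomain_quot, LinearMap.range_eq_map,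
    ← (Finsupp.basisSingleOne (R := k) (ι := V)).span_eq, Submodule.map_span,
    Finsupp.coe_basisSingleOne]
  congr 1
  ext x
  constructor
  · rintro ⟨a, _, rfl, rfl⟩
    exact ⟨_, ⟨a, rfl⟩, by simp⟩
  · rintro ⟨_, ⟨a, rfl⟩, rfl⟩
    exact ⟨a, _, rfl, by simp⟩

theorem natCard_quot_eq {V V' : Type*} [Finite V] [Finite V'] (f : V → V) (f' : V' → V')
    (β : (V →₀ k) ≃ₗ[k] (V' →₀ k))
    (h : ∀ x, Finsupp.lmapDomain k k f' (β x) = β (Finsupp.lmapDomain k k f x)) :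
    Nat.card (Quot fun x y => y = f x) = Nat.card (Quot fun x y => y = f' x) := by
  obtain ⟨γ, -⟩ := exists_equiv_of_map_ker (Finsupp.lmapDomain k k (Quot.mk fun x y => y = f x))
    (Finsupp.lmapDomain k k (Quot.mk fun x y => y = f' x))
    (lmapDomain_surjective Quot.mk_surjective) (lmapDomain_surjective Quot.mk_surjective) β (by
      rw [ker_lmapDomain_quot_fun, ker_lmapDomain_quot_fun, LinearMap.range_eq_map,
        LinearMap.range_eq_map, ← Submodule.map_comp]
      rw [← LinearEquiv.range β, LinearMap.range_eq_map, ← Submodule.map_comp]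
      congr 1
      exact LinearMap.ext fun x => by simpa using (h x).symm)
  simpa only [Module.finrank_eq_nat_card_basis (Finsupp.basisSingleOne)] using γ.finrank_eq

/-- Permutations whose linear extensions are conjugate are conjugate. -/
theorem exists_conj_of_linear_conj {V V' : Type*} [Finite V] [Finite V'] (σ : Equiv.Perm V)
    (σ' : Equiv.Perm V') (β : (V →₀ k) ≃ₗ[k] (V' →₀ k))
    (h : ∀ x, Finsupp.lmapDomain k k σ' (β x) = β (Finsupp.lmapDomain k k σ x)) :
    ∃ e : V ≃ V', ∀ v, e (σ v) = σ' (e v) := by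
  have hV : Nat.card V = Nat.card V' := by
    simpa only [Module.finrank_eq_nat_card_basis (Finsupp.basisSingleOne)] using β.finrank_eq
  obtain ⟨ε⟩ := Finite.card_eq.1 hV
  cases nonempty_fintype V
  have hn (n : ℕ) (x : V →₀ k) : Finsupp.lmapDomain k k (σ' ^ n : Equiv.Perm V') (β x) =
      β (Finsupp.lmapDomain k k (σ ^ n : Equiv.Perm V) x) := by
    induction n with
    | zero => simp
    | succ n ih =>
      rw [pow_succ', pow_succ', Equiv.Perm.coe_mul, Equiv.Perm.coe_mul, Finsupp.lmapDomain_comp,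
        Finsupp.lmapDomain_comp, LinearMap.comp_apply, LinearMap.comp_apply, ih, h]
  have hc (n : ℕ) : (ε.symm.permCongr σ') ^ n = ε.symm.permCongr (σ' ^ n) :=
    (map_pow ε.symm.permCongrHom σ' n).symm
  obtain ⟨c, hc⟩ := isConj_iff.1 <| isConj_of_natCard_quot σ (ε.symm.permCongr σ') fun n => by
    rw [hc]
    refine natCard_quot_eq (k := k) _ _ (β ≪≫ₗ Finsupp.domLCongr ε.symm) fun x => ?_
    rw [LinearEquiv.trans_apply, LinearEquiv.trans_apply, ← hn]
    have he (y : V' →₀ k) : Finsupp.domLCongr (R := k) ε.symm y =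
        Finsupp.lmapDomain k k ε.symm y := by
      simp [Finsupp.equivMapDomain_eq_mapDomain]
    rw [he, he]
    exact lmapDomain_comm (by simp [Equiv.permCongr_apply]) _
  refine ⟨c.trans ε, fun v => ?_⟩
  have := congrArg (fun τ : Equiv.Perm V => ε (τ (c v))) hc
  simpa [Equiv.permCongr_apply] using this

theorem DiGraph.LinIso.of_equiv {G G' : DiGraph} (a : G.E ≃ G'.E) (b : G.V ≃ G'.V)
    (hi : ∀ e, G'.init (a e) = b (G.init e)) (ht : ∀ e, G'.term (a e) = b (G.term e)) :
    G.LinIso k G' := by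
  have he {V W : Type} (f : V ≃ W) (y : V →₀ k) : Finsupp.domLCongr (R := k) f y =
      Finsupp.lmapDomain k k f y := by
    simp [Finsupp.equivMapDomain_eq_mapDomain]
  refine ⟨Finsupp.domLCongr a, Finsupp.domLCongr b, fun x => ?_, fun x => ?_⟩
  · rw [he, he]
    exact lmapDomain_comm hi x
  · rw [he, he]
    exact lmapDomain_comm ht x

theorem DiGraph.LinIso.exists_equiv {G G' : DiGraph} (h : G.LinIso k G')
    (hi : Function.Bijective G.init) (ht : Function.Bijective G.term)
    (hi' : Function.Bijective G'.init) (ht' : Function.Bijective G'.term) :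
    ∃ (a : G.E ≃ G'.E) (b : G.V ≃ G'.V), (∀ e, G'.init (a e) = b (G.init e)) ∧
      ∀ e, G'.term (a e) = b (G.term e) := by
  obtain ⟨α, β, h₁, h₂⟩ := h
  let i := Equiv.ofBijective _ hi
  let t := Equiv.ofBijective _ ht
  let i' := Equiv.ofBijective _ hi'
  let t' := Equiv.ofBijective _ ht'
  obtain ⟨e, he⟩ := exists_conj_of_linear_conj (t.symm.trans i) (t'.symm.trans i') β fun x => by
    obtain ⟨y, rfl⟩ := lmapDomain_surjective (k := k) ht.surjective x
    rw [← h₂, lmapDomain_comm (f' := G'.init) (g' := id), lmapDomain_comm (f' := G.init) (g' := id)]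
    · simpa using h₁ y
    · intro u
      exact congrArg i (t.symm_apply_apply u)
    · intro u
      exact congrArg i' (t'.symm_apply_apply u)
  refine ⟨t.trans (e.trans t'.symm), e, fun x => ?_, fun x => ?_⟩
  · have := he (t x)
    simp only [Equiv.trans_apply, Equiv.symm_apply_apply] at this
    exact this.symm
  · exact t'.apply_symm_apply _

end Bijective

section GroundField

variable {k k' : Type*} [Field k] [Field k']

theorem DiGraph.card_contrE_le (G : DiGraph) : Nat.card G.contr.E ≤ Nat.card G.E :=
  Nat.card_le_card_of_surjective G.contrE Quot.mk_surjective

theorem DiGraph.card_contrV_le (G : DiGraph) : Nat.card G.contr.V ≤ Nat.card G.V :=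
  Nat.card_le_card_of_surjective G.contrV Quot.mk_surjective

theorem DiGraph.card_contrE_lt (G : DiGraph) (h : ¬ Function.Injective G.term) :
    Nat.card G.contr.E < Nat.card G.E := by
  refine lt_of_le_of_ne G.card_contrE_le fun hc => h fun e e' he => ?_
  have := (Nat.bijective_iff_surjective_and_card G.contrE).2 ⟨Quot.mk_surjective, hc.symm⟩
  exact this.injective (Quot.sound he)

theorem DiGraph.card_restrE_le (G : DiGraph) : Nat.card G.restr.E ≤ Nat.card G.E :=
  Finite.card_subtype_le _

theorem DiGraph.card_restrV_le (G : DiGraph) : Nat.card G.restr.V ≤ Nat.card G.V :=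
  Finite.card_subtype_le _

theorem DiGraph.card_restrV_lt (G : DiGraph) (h : ¬ Function.Surjective G.term) :
    Nat.card G.restr.V < Nat.card G.V := by
  rw [Function.Surjective] at h
  push Not at h
  obtain ⟨v, hv⟩ := h
  exact Finite.card_subtype_lt (x := v) fun ⟨e, he⟩ => hv e he

/-- The total number of edges and vertices. -/
noncomputable def DiGraph.size (G : DiGraph) : ℕ := Nat.card G.E + Nat.card G.V

theorem DiGraph.LinIso.change_field {G G' : DiGraph} (h : G.LinIso k G') : G.LinIso k' G' := by
  induction hn : G.size + G'.size using Nat.strong_induction_on generalizing G G' with | _ n ih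
  have contr {H H' : DiGraph} (h : H.LinIso k H') (hs : H.size + H'.size = n)
      (ht : ¬ (Function.Injective H.term ∧ Function.Injective H'.term)) : H.LinIso k' H' := by
    rw [linIso_iff_contr] at h ⊢
    refine ⟨h.1, h.2.1, ih _ ?_ h.2.2 rfl⟩
    have := H.card_contrE_le
    have := H'.card_contrE_le
    have := H.card_contrV_le
    have := H'.card_contrV_le
    unfold size at *
    rcases not_and_or.1 ht with ht | ht
    · have := H.card_contrE_lt ht
      omega
    · have := H'.card_contrE_lt ht
      omega
  by_cases ht : Function.Injective G.term ∧ Function.Injective G'.term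
  swap
  · exact contr h hn ht
  by_cases hi : Function.Injective G.init ∧ Function.Injective G'.init
  swap
  · exact (contr h.rev hn hi).rev
  by_cases hs : Function.Surjective G.term ∧ Function.Surjective G'.term
  swap
  · rw [linIso_iff_restr _ _ hi.1 hi.2] at h ⊢
    refine ⟨h.1, h.2.1, ih _ ?_ h.2.2 rfl⟩
    have := G.card_restrE_le
    have := G'.card_restrE_le
    have := G.card_restrV_le
    have := G'.card_restrV_le
    unfold size at *
    rcases not_and_or.1 hs with hs | hs
    · have := G.card_restrV_lt hs
      omega
    · have := G'.card_restrV_lt hs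
      omega
  have bij {H : DiGraph} (hi : Function.Injective H.init) (ht : Function.Bijective H.term) :
      Function.Bijective H.init :=
    ⟨hi, (Finite.injective_iff_surjective_of_equiv (Equiv.ofBijective _ ht)).1 hi⟩
  have hb : Function.Bijective G.term := ⟨ht.1, hs.1⟩
  have hb' : Function.Bijective G'.term := ⟨ht.2, hs.2⟩
  obtain ⟨a, b, h₁, h₂⟩ := h.exists_equiv (bij hi.1 hb) hb (bij hi.2 hb') hb'
  exact .of_equiv a b h₁ h₂

/-- The digraph of a binary relation. -/
def BRel.toDiGraph (Γ : BRel) : DiGraph where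
  E := {p : Γ.S × Γ.S // Γ.R p.1 p.2}
  V := Γ.S
  init e := e.1.1
  term e := e.1.2

theorem toLin'_linearEquivFunOnFinite {E V : Type*} [Finite V] {_ : Fintype E}
    {_ : DecidableEq E} {_ : DecidableEq V} (f : E → V) (x : E →₀ k) :
    Matrix.toLin' (Matrix.of fun (v : V) (e : E) => if f e = v then (1 : k) else 0)
        (Finsupp.linearEquivFunOnFinite k k E x) =
      Finsupp.linearEquivFunOnFinite k k V (Finsupp.lmapDomain k k f x) := by
  induction x using Finsupp.induction_linear with
  | zero => simp
  | add x y hx hy => rw [map_add, map_add, hx, hy, map_add, map_add]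
  | single e a =>
    ext v
    simp [Matrix.mulVec, dotProduct, Finsupp.single_apply, Pi.single_apply]

theorem PairIso.of_equiv {E V E' V' E₁ V₁ E₁' V₁' : Type*}
    [AddCommGroup E] [Module k E] [AddCommGroup V] [Module k V]
    [AddCommGroup E'] [Module k E'] [AddCommGroup V'] [Module k V']
    [AddCommGroup E₁] [Module k E₁] [AddCommGroup V₁] [Module k V₁]
    [AddCommGroup E₁'] [Module k E₁'] [AddCommGroup V₁'] [Module k V₁']
    {μ ν : E →ₗ[k] V} {μ' ν' : E' →ₗ[k] V'} {μ₁ ν₁ : E₁ →ₗ[k] V₁} {μ₁' ν₁' : E₁' →ₗ[k] V₁'}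
    (h : PairIso μ ν μ' ν') (h₁ : PairIso μ ν μ₁ ν₁) (h₁' : PairIso μ' ν' μ₁' ν₁') :
    PairIso μ₁ ν₁ μ₁' ν₁' := by
  obtain ⟨α, β, hμ, hν⟩ := h
  obtain ⟨a, b, ha, hb⟩ := h₁
  obtain ⟨a', b', ha', hb'⟩ := h₁'
  refine ⟨a.symm ≪≫ₗ α ≪≫ₗ a', b.symm ≪≫ₗ β ≪≫ₗ b', fun x => ?_, fun x => ?_⟩ <;>
    obtain ⟨y, rfl⟩ := a.surjective x
  · simp [ha, hμ, ha']
  · simp [hb, hν, hb']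

theorem PairIso.symm {E V E' V' : Type*}
    [AddCommGroup E] [Module k E] [AddCommGroup V] [Module k V]
    [AddCommGroup E'] [Module k E'] [AddCommGroup V'] [Module k V']
    {μ ν : E →ₗ[k] V} {μ' ν' : E' →ₗ[k] V'} (h : PairIso μ ν μ' ν') : PairIso μ' ν' μ ν := by
  obtain ⟨α, β, hμ, hν⟩ := h
  refine ⟨α.symm, β.symm, fun x => ?_, fun x => ?_⟩ <;> obtain ⟨y, rfl⟩ := α.surjective x
  · simp [hμ]
  · simp [hν]

theorem BRel.pairIso_linz (K : Type) [Field K] (Γ : BRel) :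
    PairIso (Finsupp.lmapDomain K K Γ.toDiGraph.init) (Finsupp.lmapDomain K K Γ.toDiGraph.term)
      (Γ.linz K).mu (Γ.linz K).nu := by
  exact ⟨Finsupp.linearEquivFunOnFinite K K _, Finsupp.linearEquivFunOnFinite K K _,
    fun x => toLin'_linearEquivFunOnFinite Γ.toDiGraph.init x,
    fun x => toLin'_linearEquivFunOnFinite Γ.toDiGraph.term x⟩

theorem BRel.iso_linz_iff (K : Type) [Field K] (Γ Γ' : BRel) :
    Pair.Iso K (Γ.linz K) (Γ'.linz K) ↔ Γ.toDiGraph.LinIso K Γ'.toDiGraph :=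
  ⟨fun h => PairIso.of_equiv h (Γ.pairIso_linz K).symm (Γ'.pairIso_linz K).symm,
    fun h => PairIso.of_equiv h (Γ.pairIso_linz K) (Γ'.pairIso_linz K)⟩

end GroundField

/-- Linear equivalence of finite binary relations is independent of
the ground field. -/
theorem stmt15 (K K' : Type) [Field K] [Field K'] (Γ Γ' : BRel) :
    Pair.Iso K (Γ.linz K) (Γ'.linz K) ↔ Pair.Iso K' (Γ.linz K') (Γ'.linz K') := by
  rw [BRel.iso_linz_iff, BRel.iso_linz_iff]
  exact ⟨fun h => h.change_field, fun h => h.change_field⟩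

end Towber
end

section
/- Let K be a field. Every transformation-pair over K (i.e., every pair of K-linear maps μ,ν : E → V between finite-dimensional K-vector spaces) is isomorphic to a finite direct sum of members of Kronecker's list L(K). -/
open Polynomial

namespace Towber

variable (K : Type) [Field K]

section KroneckerClassification

variable {K}

theorem Pair.Iso.refl (τ : Pair K) : Pair.Iso K τ τ :=
  ⟨.refl K _, .refl K _, fun _ => rfl, fun _ => rfl⟩

theorem Pair.Iso.symm {τ σ : Pair K} (h : Pair.Iso K τ σ) : Pair.Iso K σ τ := by
  obtain ⟨α, β, hμ, hν⟩ := h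
  refine ⟨α.symm, β.symm, fun x => ?_, fun x => ?_⟩
  · rw [LinearEquiv.eq_symm_apply, ← hμ, α.apply_symm_apply]
  · rw [LinearEquiv.eq_symm_apply, ← hν, α.apply_symm_apply]

theorem Pair.Iso.trans {τ σ ρ : Pair K} (h : Pair.Iso K τ σ) (h' : Pair.Iso K σ ρ) :
    Pair.Iso K τ ρ := by
  obtain ⟨α, β, hμ, hν⟩ := h
  obtain ⟨α', β', hμ', hν'⟩ := h'
  exact ⟨α.trans α', β.trans β', fun x => by simp [hμ, hμ'], fun x => by simp [hν, hν']⟩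

theorem Pair.Iso.dSum {ι : Type} [Finite ι] {τ σ : ι → Pair K}
    (h : ∀ i, Pair.Iso K (τ i) (σ i)) : Pair.Iso K (dSum K ι τ) (dSum K ι σ) := by
  choose α β hμ hν using h
  exact ⟨LinearEquiv.piCongrRight α, LinearEquiv.piCongrRight β,
    fun x => funext fun i => hμ i (x i), fun x => funext fun i => hν i (x i)⟩

theorem Pair.Iso.dSum2 {τ τ' σ σ' : Pair K} (h : Pair.Iso K τ τ') (h' : Pair.Iso K σ σ') :
    Pair.Iso K (dSum2 K τ σ) (dSum2 K τ' σ') := by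
  obtain ⟨α, β, hμ, hν⟩ := h
  obtain ⟨α', β', hμ', hν'⟩ := h'
  exact ⟨α.prodCongr α', β.prodCongr β', fun x => Prod.ext (hμ x.1) (hμ' x.2),
    fun x => Prod.ext (hν x.1) (hν' x.2)⟩

theorem dSum_reindex {ι κ : Type} [Finite ι] [Finite κ] (e : ι ≃ κ) (σ : κ → Pair K) :
    Pair.Iso K (dSum K ι fun i => σ (e i)) (dSum K κ σ) :=
  Pair.Iso.symm ⟨(LinearEquiv.piCongrLeft K (fun k => (σ k).E) e).symm,
    (LinearEquiv.piCongrLeft K (fun k => (σ k).V) e).symm, fun _ => rfl, fun _ => rfl⟩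

theorem dSum_sigma {ι : Type} [Finite ι] {κ : ι → Type} [∀ i, Finite (κ i)]
    (σ : ∀ i, κ i → Pair K) :
    Pair.Iso K (dSum K ι fun i => dSum K (κ i) (σ i)) (dSum K (Sigma κ) fun p => σ p.1 p.2) :=
  Pair.Iso.symm ⟨LinearEquiv.piCurry K fun i k => (σ i k).E,
    LinearEquiv.piCurry K fun i k => (σ i k).V, fun _ => rfl, fun _ => rfl⟩

theorem dSum_sum {ι κ : Type} [Finite ι] [Finite κ] (σ : ι ⊕ κ → Pair K) :
    Pair.Iso K (dSum K (ι ⊕ κ) σ)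
      (dSum2 K (dSum K ι fun i => σ (.inl i)) (dSum K κ fun i => σ (.inr i))) :=
  ⟨LinearEquiv.sumPiEquivProdPi K ι κ fun i => (σ i).E,
    LinearEquiv.sumPiEquivProdPi K ι κ fun i => (σ i).V, fun _ => rfl, fun _ => rfl⟩

/-- Being isomorphic to a finite direct sum of members of Kronecker's list. -/
def IsKronSum (τ : Pair K) : Prop :=
  ∃ (ι : Type) (_ : Finite ι) (σ : ι → Pair K),
    (∀ i, IsKron K (σ i)) ∧ Pair.Iso K τ (dSum K ι σ)

theorem IsKronSum.of_iso {τ σ : Pair K} (hσ : IsKronSum σ) (h : Pair.Iso K τ σ) :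
    IsKronSum τ := by
  obtain ⟨ι, _, ρ, hρ, e⟩ := hσ
  exact ⟨ι, _, ρ, hρ, h.trans e⟩

theorem IsKron.isKronSum {τ : Pair K} (h : IsKron K τ) : IsKronSum τ :=
  ⟨Unit, inferInstance, fun _ => τ, fun _ => h,
    Pair.Iso.symm ⟨LinearEquiv.funUnique Unit K τ.E, LinearEquiv.funUnique Unit K τ.V,
      fun _ => rfl, fun _ => rfl⟩⟩

theorem IsKronSum.dSum {ι : Type} [Finite ι] {τ : ι → Pair K} (h : ∀ i, IsKronSum (τ i)) :
    IsKronSum (dSum K ι τ) := by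
  choose κ _ σ hσ e using h
  exact ⟨Sigma κ, inferInstance, fun p => σ p.1 p.2, fun p => hσ p.1 p.2,
    (Pair.Iso.dSum e).trans (dSum_sigma σ)⟩

theorem IsKronSum.dSum2 {τ σ : Pair K} (hτ : IsKronSum τ) (hσ : IsKronSum σ) :
    IsKronSum (dSum2 K τ σ) := by
  obtain ⟨ι, _, ρ, hρ, e⟩ := hτ
  obtain ⟨ι', _, ρ', hρ', e'⟩ := hσ
  exact ⟨ι ⊕ ι', inferInstance, Sum.elim ρ ρ', by rintro (i | i); exacts [hρ i, hρ' i],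
    (e.dSum2 e').trans (dSum_sum (Sum.elim ρ ρ')).symm⟩

theorem isKronSum_of_subsingleton (τ : Pair K) [Subsingleton τ.E] [Subsingleton τ.V] :
    IsKronSum τ := by
  have : Subsingleton (dSum K Empty Empty.elim).E := ⟨fun _ _ => funext fun i => i.elim⟩
  have : Subsingleton (dSum K Empty Empty.elim).V := ⟨fun _ _ => funext fun i => i.elim⟩
  exact ⟨Empty, inferInstance, Empty.elim, fun i => i.elim, LinearEquiv.ofSubsingleton _ _,
    LinearEquiv.ofSubsingleton _ _, fun _ => Subsingleton.elim _ _,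
    fun _ => Subsingleton.elim _ _⟩

/-! ### Matrix computations -/

theorem toLin'_shift_zero {m : ℕ} (x : Fin (m + 1) → K) :
    Matrix.toLin' (Matrix.of fun j i : Fin (m + 1) => if (i : ℕ) + 1 = (j : ℕ) then (1 : K) else 0)
      x 0 = 0 := by
  simp [Matrix.mulVec, dotProduct]

theorem toLin'_shift_succ {m : ℕ} (x : Fin (m + 1) → K) (k : Fin m) :
    Matrix.toLin' (Matrix.of fun j i : Fin (m + 1) => if (i : ℕ) + 1 = (j : ℕ) then (1 : K) else 0)
      x k.succ = x k.castSucc := by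
  rw [Matrix.toLin'_apply, Matrix.mulVec, dotProduct, Finset.sum_eq_single k.castSucc]
  · simp
  · intro b _ hb
    simp [Fin.ext_iff] at hb
    simp [hb]
  · simp

theorem Tn_mu_castSucc {n : ℕ} (x : Fin n → K) (k : Fin n) :
    ((Tn K n).mu x : Fin (n + 1) → K) k.castSucc = x k := by
  change Matrix.toLin' _ x _ = _
  rw [Matrix.toLin'_apply, Matrix.mulVec, dotProduct, Finset.sum_eq_single k]
  · simp
  · intro b _ hb
    simp [Fin.ext_iff] at hb
    simp [Ne.symm hb]
  · simp

theorem Tn_mu_last {n : ℕ} (x : Fin n → K) :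
    ((Tn K n).mu x : Fin (n + 1) → K) (Fin.last n) = 0 := by
  change Matrix.toLin' _ x _ = _
  rw [Matrix.toLin'_apply, Matrix.mulVec, dotProduct]
  exact Finset.sum_eq_zero fun i _ => by simp [i.2.ne']

theorem Tn_mu {n : ℕ} (x : Fin n → K) : (Tn K n).mu x = (Fin.snoc x 0 : Fin (n + 1) → K) := by
  funext k
  cases k using Fin.lastCases with
  | last => rw [Tn_mu_last, Fin.snoc_last]
  | cast k => rw [Tn_mu_castSucc, Fin.snoc_castSucc]

theorem Tn_nu {n : ℕ} (x : Fin n → K) : (Tn K n).nu x = (Fin.cons 0 x : Fin (n + 1) → K) := by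
  change Matrix.toLin' _ x = _
  funext k
  rw [Matrix.toLin'_apply, Matrix.mulVec, dotProduct]
  cases k using Fin.cases with
  | zero => simp
  | succ k => simp [Fin.val_inj]

theorem zTz_nu {n : ℕ} (x : Fin (n + 1) → K) : (zTz K n).nu x = (Fin.tail x : Fin n → K) := by
  change Matrix.toLin' _ x = _
  funext k
  rw [Matrix.toLin'_apply, Matrix.mulVec, dotProduct, Finset.sum_eq_single k.succ]
  · simp [Fin.tail]
  · intro b _ hb
    simp [Fin.ext_iff] at hb
    simp [Ne.symm hb]
  · simp

/-! ### Pairs whose second map is bijective -/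

theorem zT_iso_SP (n : ℕ) (h : (X ^ n : K[X]) ≠ 0) : Pair.Iso K (SP K (X ^ n) h) (zT K n) := by
  let pb := AdjoinRoot.powerBasis' (monic_X_pow n : (X ^ n : K[X]).Monic)
  let b : Module.Basis (Fin n) K (AdjoinRoot (X ^ n : K[X])) :=
    pb.basis.reindex (finCongr (natDegree_X_pow n))
  have hb (i : Fin n) : b i = AdjoinRoot.root (X ^ n : K[X]) ^ (i : ℕ) := by
    simp only [b, pb, Module.Basis.reindex_apply, PowerBasis.basis_eq_pow]
    rfl
  have hroot : AdjoinRoot.root (X ^ n : K[X]) ^ n = 0 := by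
    have := AdjoinRoot.mk_self (f := (X ^ n : K[X]))
    rwa [map_pow, AdjoinRoot.mk_X] at this
  refine Pair.Iso.symm ⟨b.equivFun.symm, b.equivFun.symm, fun (x : Fin n → K) => ?_,
    fun (x : Fin n → K) => ?_⟩
  · change AdjoinRoot.root _ * b.equivFun.symm x = b.equivFun.symm (Matrix.toLin' _ x)
    rw [b.equivFun_symm_apply, b.equivFun_symm_apply]
    simp only [hb]
    cases n with
    | zero => simp
    | succ m =>
      rw [Fin.sum_univ_succ (fun i : Fin (m + 1) => Matrix.toLin' _ x i • _),
        Fin.sum_univ_castSucc]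
      simp only [toLin'_shift_zero, toLin'_shift_succ]
      simp only [mul_add, Finset.mul_sum, mul_smul_comm, ← pow_succ', Fin.val_castSucc,
        Fin.val_last, hroot, Fin.val_succ]
      simp
  · change b.equivFun.symm x = b.equivFun.symm (Matrix.toLin' 1 x)
    rw [Matrix.toLin'_one, LinearMap.id_apply]

/-- The pair `[φ, I : V → V]`. -/
noncomputable def ofEnd {V : Type} [AddCommGroup V] [Module K V] [FiniteDimensional K V]
    (φ : V →ₗ[K] V) : Pair K :=
  ⟨V, V, φ, LinearMap.id⟩

theorem finite_quotient_span {p : K[X]} (hp : p ≠ 0) :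
    FiniteDimensional K (K[X] ⧸ Submodule.span K[X] {p}) :=
  (AdjoinRoot.powerBasis hp).finite

theorem isKronSum_ofEnd_quotient {p : K[X]} (hp : Irreducible p) (n : ℕ)
    [FiniteDimensional K (K[X] ⧸ Submodule.span K[X] {p ^ n})] :
    IsKronSum (ofEnd (LinearMap.lsmul K[X] (K[X] ⧸ Submodule.span K[X] {p ^ n}) X
      |>.restrictScalars K)) := by
  classical
  have hassoc : Associated p (normalize p) := (normalize_associated p).symm
  have hq : Irreducible (normalize p) := hassoc.irreducible hp
  have hqm : (normalize p).Monic := monic_normalize hp.ne_zero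
  have hspan : Submodule.span K[X] {p ^ n} = Submodule.span K[X] {normalize p ^ n} :=
    Ideal.span_singleton_eq_span_singleton.2 (hassoc.pow_pow)
  rcases Nat.eq_zero_or_pos n with rfl | hn
  · have : Subsingleton (K[X] ⧸ Submodule.span K[X] {p ^ 0}) := by
      rw [Submodule.Quotient.subsingleton_iff, pow_zero]
      exact Ideal.span_singleton_one
    have : Subsingleton (ofEnd (LinearMap.lsmul K[X] (K[X] ⧸ Submodule.span K[X] {p ^ 0}) X
      |>.restrictScalars K)).E := this
    have : Subsingleton (ofEnd (LinearMap.lsmul K[X] (K[X] ⧸ Submodule.span K[X] {p ^ 0}) X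
      |>.restrictScalars K)).V := this
    exact isKronSum_of_subsingleton _
  · have h0 : normalize p ^ n ≠ 0 := pow_ne_zero _ hq.ne_zero
    have hSP : IsKronSum (SP K (normalize p ^ n) h0) := by
      refine IsKron.isKronSum ?_
      by_cases hX : normalize p = X
      · refine Or.inl ⟨n, hn, ?_⟩
        simp only [hX]
        exact zT_iso_SP n _
      · exact Or.inr <| Or.inr <| Or.inr <| Or.inr
          ⟨normalize p, n, hqm, hq, hX, hn, h0, Pair.Iso.refl _⟩
    refine hSP.of_iso ?_
    let e : (K[X] ⧸ Submodule.span K[X] {p ^ n}) ≃ₗ[K]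
        (K[X] ⧸ Submodule.span K[X] {normalize p ^ n}) :=
      (Submodule.quotEquivOfEq _ _ hspan).restrictScalars K
    refine ⟨e, e, fun x => ?_, fun _ => rfl⟩
    obtain ⟨f, rfl⟩ := Submodule.Quotient.mk_surjective _ x
    rfl

theorem isKronSum_ofEnd {V : Type} [AddCommGroup V] [Module K V] [FiniteDimensional K V]
    (φ : V →ₗ[K] V) : IsKronSum (ofEnd φ) := by
  obtain ⟨ι, _, p, hp, e, ⟨f⟩⟩ := Module.equiv_directSum_of_isTorsion
    (Module.AEval.isTorsion_of_finiteDimensional K V φ)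
  have (i : ι) : FiniteDimensional K (K[X] ⧸ Submodule.span K[X] {p i ^ e i}) :=
    finite_quotient_span (pow_ne_zero _ (hp i).ne_zero)
  refine (IsKronSum.dSum fun i => isKronSum_ofEnd_quotient (hp i) (e i)).of_iso ?_
  classical
  let g := f.trans (DirectSum.linearEquivFunOnFintype K[X] ι _)
  let h : V ≃ₗ[K] ∀ i, K[X] ⧸ Submodule.span K[X] {p i ^ e i} :=
    (Module.AEval'.of φ).trans (g.restrictScalars K)
  refine ⟨h, h, fun (x : V) => ?_, fun _ => rfl⟩
  change (X : K[X]) • g (Module.AEval'.of φ x) = g (Module.AEval'.of φ (φ x))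
  rw [← Module.AEval'.X_smul_of, map_smul]

theorem isKronSum_of_bijective_nu {τ : Pair K} (h : Function.Bijective τ.nu) : IsKronSum τ := by
  let e := LinearEquiv.ofBijective τ.nu h
  refine (isKronSum_ofEnd (τ.mu ∘ₗ e.symm.toLinearMap)).of_iso
    ⟨e, .refl K _, fun x => ?_, fun _ => rfl⟩
  change τ.mu (e.symm (e x)) = τ.mu x
  rw [e.symm_apply_apply]

/-! ### Adjoining the cokernel of the second map -/

/-- A linear map `j : C → V` inducing an isomorphism of `C` with the cokernel of `ν`. -/
structure IsCokernelLift (τ : Pair K) {C : Type} [AddCommGroup C] [Module K C]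
    (j : C →ₗ[K] τ.V) : Prop where
  eq_zero : ∀ c e, j c + τ.nu e = 0 → c = 0
  exists_eq : ∀ v, ∃ c e, j c + τ.nu e = v

/-- The pair `[I ⊕ μ, j + ν : C ⊕ E → C ⊕ V]` with the image of the second map lying in `V`. -/
noncomputable def cokerExt (τ : Pair K) {C : Type} [AddCommGroup C] [Module K C]
    [FiniteDimensional K C] (j : C →ₗ[K] τ.V) : Pair K :=
  ⟨C × τ.E, C × τ.V, LinearMap.id.prodMap τ.mu, LinearMap.inr K C τ.V ∘ₗ j.coprod τ.nu⟩

theorem Pair.Iso.cokerExt {τ τ' : Pair K} (h : Pair.Iso K τ τ')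
    {C C' : Type} [AddCommGroup C] [Module K C] [FiniteDimensional K C]
    [AddCommGroup C'] [Module K C'] [FiniteDimensional K C']
    {j : C →ₗ[K] τ.V} {j' : C' →ₗ[K] τ'.V} (hj : IsCokernelLift τ j)
    (hj' : IsCokernelLift τ' j') : Pair.Iso K (cokerExt τ j) (cokerExt τ' j') := by
  obtain ⟨α, β, hμ, hν⟩ := h
  obtain ⟨g, hg⟩ := (j'.coprod τ'.nu).exists_rightInverse_of_surjective
    (LinearMap.range_eq_top.2 fun v => by
      obtain ⟨c, e, h⟩ := hj'.exists_eq v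
      exact ⟨(c, e), h⟩)
  let γ : C →ₗ[K] C' := LinearMap.fst K C' τ'.E ∘ₗ g ∘ₗ β.toLinearMap ∘ₗ j
  let s : C →ₗ[K] τ'.E := LinearMap.snd K C' τ'.E ∘ₗ g ∘ₗ β.toLinearMap ∘ₗ j
  have hs (c : C) : j' (γ c) + τ'.nu (s c) = β (j c) := LinearMap.congr_fun hg (β (j c))
  have hγ : Function.Bijective γ := by
    constructor
    · rw [injective_iff_map_eq_zero]
      intro c hc
      refine hj.eq_zero c (-α.symm (s c)) (β.injective ?_)
      rw [map_add, ← hs, ← hν, hc]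
      simp
    · intro c'
      obtain ⟨c, e, h⟩ := hj.exists_eq (β.symm (j' c'))
      refine ⟨c, (sub_eq_zero.1 (hj'.eq_zero _ (-(s c + α e)) ?_)).symm⟩
      have h2 : β (j c) + τ'.nu (α e) = j' c' := by
        rw [hν, ← map_add, h, β.apply_symm_apply]
      rw [map_sub, ← h2, ← hs, map_neg, map_add]
      abel
  refine ⟨(LinearEquiv.ofBijective γ hγ).skewProd α s,
    (LinearEquiv.ofBijective γ hγ).skewProd β (τ'.mu ∘ₗ s), ?_, ?_⟩
  · rintro ⟨c, e⟩
    refine Prod.ext rfl ?_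
    change τ'.mu (α e + s c) = β (τ.mu e) + τ'.mu (s c)
    rw [map_add, hμ]
  · rintro ⟨c, e⟩
    refine Prod.ext (map_zero γ).symm ?_
    change j' (γ c) + τ'.nu (α e + s c) = β (j c + τ.nu e) + τ'.mu (s 0)
    rw [map_add, map_add, map_zero, map_zero, hν, ← hs]
    abel

theorem IsCokernelLift.dSum {ι : Type} [Finite ι] {σ : ι → Pair K} {C : ι → Type}
    [∀ i, AddCommGroup (C i)] [∀ i, Module K (C i)] {j : ∀ i, C i →ₗ[K] (σ i).V}
    (hj : ∀ i, IsCokernelLift (σ i) (j i)) :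
    IsCokernelLift (dSum K ι σ) (LinearMap.pi fun i => j i ∘ₗ LinearMap.proj i) where
  eq_zero c e h := funext fun i => (hj i).eq_zero (c i) (e i) (congrFun h i)
  exists_eq v := by
    choose c e h using fun i => (hj i).exists_eq (v i)
    exact ⟨c, e, funext h⟩

theorem cokerExt_dSum {ι : Type} [Finite ι] (σ : ι → Pair K) {C : ι → Type}
    [∀ i, AddCommGroup (C i)] [∀ i, Module K (C i)] [∀ i, FiniteDimensional K (C i)]
    (j : ∀ i, C i →ₗ[K] (σ i).V) :
    Pair.Iso K (cokerExt (dSum K ι σ) (LinearMap.pi fun i => j i ∘ₗ LinearMap.proj i))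
      (dSum K ι fun i => cokerExt (σ i) (j i)) :=
  ⟨{ toFun := fun x i => (x.1 i, x.2 i)
     invFun := fun y => (fun i => (y i).1, fun i => (y i).2)
     map_add' := fun _ _ => rfl
     map_smul' := fun _ _ => rfl
     left_inv := fun _ => rfl
     right_inv := fun _ => rfl },
   { toFun := fun x i => (x.1 i, x.2 i)
     invFun := fun y => (fun i => (y i).1, fun i => (y i).2)
     map_add' := fun _ _ => rfl
     map_smul' := fun _ _ => rfl
     left_inv := fun _ => rfl
     right_inv := fun _ => rfl }, fun _ => rfl, fun _ => rfl⟩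

/-- Some extension of `τ` by the cokernel of its second map is a sum of members of
Kronecker's list. -/
def HasKronSumCokerExt (τ : Pair K) : Prop :=
  ∃ (C : Type) (_ : AddCommGroup C) (_ : Module K C) (_ : FiniteDimensional K C)
    (j : C →ₗ[K] τ.V), IsCokernelLift τ j ∧ IsKronSum (cokerExt τ j)

theorem HasKronSumCokerExt.of_iso {τ τ' : Pair K} (h : HasKronSumCokerExt τ')
    (e : Pair.Iso K τ τ') : HasKronSumCokerExt τ := by
  obtain ⟨C, _, _, _, j, hj, hK⟩ := h
  obtain ⟨α, β, hμ, hν⟩ := id e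
  have hj' : IsCokernelLift τ (β.symm.toLinearMap ∘ₗ j) := by
    constructor
    · intro c x h
      refine hj.eq_zero c (α x) ?_
      have := congrArg β h
      rw [map_add, map_zero, ← hν] at this
      rw [← this]
      simp
    · intro v
      obtain ⟨c, x, h⟩ := hj.exists_eq (β v)
      refine ⟨c, α.symm x, β.injective ?_⟩
      rw [map_add, ← hν, ← h]
      simp
  exact ⟨C, _, _, _, _, hj', hK.of_iso (e.cokerExt hj' hj)⟩

theorem IsKronSum.hasKronSumCokerExt_of_surjective {τ : Pair K} (h : IsKronSum τ)
    (hν : Function.Surjective τ.nu) : HasKronSumCokerExt τ := by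
  refine ⟨PUnit, inferInstance, inferInstance, inferInstance, 0, ⟨fun _ _ _ => rfl, fun v => ?_⟩,
    h.of_iso ⟨LinearEquiv.uniqueProd, LinearEquiv.uniqueProd, fun _ => rfl, fun x => ?_⟩⟩
  · obtain ⟨e, rfl⟩ := hν v
    exact ⟨0, e, by simp⟩
  · change τ.nu x.2 = (0 : τ.V) + τ.nu x.2
    rw [zero_add]

theorem hasKronSumCokerExt_Tn (n : ℕ) : HasKronSumCokerExt (Tn K n) := by
  let j : K →ₗ[K] (Tn K n).V := LinearMap.single K (fun _ : Fin (n + 1) => K) 0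
  have key (c : K) (e : Fin n → K) :
      j c + (Tn K n).nu e = (Fin.cons c e : Fin (n + 1) → K) := by
    funext k
    change (Pi.single 0 c : Fin (n + 1) → K) k + ((Tn K n).nu e : Fin (n + 1) → K) k = _
    rw [Tn_nu]
    cases k using Fin.cases <;> simp
  refine ⟨K, inferInstance, inferInstance, inferInstance, j, ⟨fun c (e : Fin n → K) h => ?_,
    fun (v : Fin (n + 1) → K) => ?_⟩,
    IsKron.isKronSum <| Or.inr <| Or.inr <| Or.inl ⟨n + 1,
      Fin.consLinearEquiv K fun _ => K, Fin.consLinearEquiv K fun _ => K, ?_, ?_⟩⟩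
  · rw [key] at h
    exact congrFun h 0
  · exact ⟨v 0, Fin.tail v, by rw [key, Fin.cons_self_tail]⟩
  · rintro ⟨c, (e : Fin n → K)⟩
    change (Tn K (n + 1)).mu (Fin.cons c e : Fin (n + 1) → K) =
      (Fin.cons c ((Tn K n).mu e) : Fin (n + 2) → K)
    rw [Tn_mu, Tn_mu, Fin.cons_snoc_eq_snoc_cons]
  · rintro ⟨c, (e : Fin n → K)⟩
    change (Tn K (n + 1)).nu (Fin.cons c e : Fin (n + 1) → K) =
      (Fin.cons 0 (j c + (Tn K n).nu e) : Fin (n + 2) → K)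
    rw [Tn_nu, key]

theorem Tz_nu {m : ℕ} (e : Fin (m + 1) → K) :
    (Tz K (m + 1)).nu e = (Fin.cons 0 (Fin.init e) : Fin (m + 1) → K) := by
  funext k
  cases k using Fin.cases with
  | zero => exact toLin'_shift_zero _
  | succ k => exact toLin'_shift_succ _ k

theorem hasKronSumCokerExt_Tz (m : ℕ) : HasKronSumCokerExt (Tz K (m + 1)) := by
  let j : K →ₗ[K] (Tz K (m + 1)).V := LinearMap.single K (fun _ : Fin (m + 1) => K) 0
  have key (c : K) (e : Fin (m + 1) → K) :
      j c + (Tz K (m + 1)).nu e = (Fin.cons c (Fin.init e) : Fin (m + 1) → K) := by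
    funext k
    change (Pi.single 0 c : Fin (m + 1) → K) k + ((Tz K (m + 1)).nu e : Fin (m + 1) → K) k = _
    rw [Tz_nu]
    cases k using Fin.cases <;> simp
  refine ⟨K, inferInstance, inferInstance, inferInstance, j, ⟨fun c (e : Fin (m + 1) → K) h => ?_,
    fun (v : Fin (m + 1) → K) => ?_⟩,
    IsKron.isKronSum <| Or.inr <| Or.inl ⟨m + 2, by omega,
      Fin.consLinearEquiv K fun _ => K, Fin.consLinearEquiv K fun _ => K, ?_, ?_⟩⟩
  · rw [key] at h
    exact congrFun h 0
  · exact ⟨v 0, Fin.snoc (Fin.tail v) 0, by rw [key, Fin.init_snoc, Fin.cons_self_tail]⟩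
  · rintro ⟨c, (e : Fin (m + 1) → K)⟩
    change Matrix.toLin' 1 (Fin.cons c e : Fin (m + 2) → K) =
      (Fin.cons c (Matrix.toLin' 1 e) : Fin (m + 2) → K)
    rw [Matrix.toLin'_one, Matrix.toLin'_one]
    rfl
  · rintro ⟨c, (e : Fin (m + 1) → K)⟩
    change (Tz K (m + 2)).nu (Fin.cons c e : Fin (m + 2) → K) =
      (Fin.cons 0 (j c + (Tz K (m + 1)).nu e) : Fin (m + 2) → K)
    rw [Tz_nu, key]
    congr 1
    funext k
    cases k using Fin.cases <;> rfl

theorem zT_nu_bijective (n : ℕ) : Function.Bijective (zT K n).nu := by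
  change Function.Bijective (Matrix.toLin' (1 : Matrix (Fin n) (Fin n) K))
  rw [Matrix.toLin'_one]
  exact Function.bijective_id

theorem IsKron.hasKronSumCokerExt {τ : Pair K} (h : IsKron K τ) : HasKronSumCokerExt τ := by
  rcases h with ⟨n, -, h⟩ | ⟨n, hn, h⟩ | ⟨n, h⟩ | ⟨n, h⟩ | ⟨p, n, -, -, -, -, h0, h⟩ <;>
    refine HasKronSumCokerExt.of_iso ?_ h
  · exact (isKronSum_of_bijective_nu (zT_nu_bijective n)).hasKronSumCokerExt_of_surjective
      (zT_nu_bijective n).2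
  · obtain ⟨m, rfl⟩ := Nat.exists_eq_add_of_le' hn
    exact hasKronSumCokerExt_Tz m
  · exact hasKronSumCokerExt_Tn n
  · refine IsKronSum.hasKronSumCokerExt_of_surjective
      (IsKron.isKronSum <| Or.inr <| Or.inr <| Or.inr <| Or.inl ⟨n, Pair.Iso.refl _⟩) fun v => ?_
    exact ⟨(Fin.cons 0 v : Fin (n + 1) → K), zTz_nu _⟩
  · exact (isKronSum_of_bijective_nu Function.bijective_id).hasKronSumCokerExt_of_surjective
      Function.surjective_id

theorem IsKronSum.cokerExt {τ : Pair K} (h : IsKronSum τ) {C : Type} [AddCommGroup C]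
    [Module K C] [FiniteDimensional K C] {j : C →ₗ[K] τ.V} (hj : IsCokernelLift τ j) :
    IsKronSum (cokerExt τ j) := by
  obtain ⟨ι, _, σ, hσ, e⟩ := h
  choose D _ _ _ i hi hK using fun k => (hσ k).hasKronSumCokerExt
  exact (IsKronSum.dSum hK).of_iso ((e.cokerExt hj (.dSum hi)).trans (cokerExt_dSum σ i))

/-! ### Pairs whose second map is not surjective -/

theorem isKronSum_id_zero (C : Type) [AddCommGroup C] [Module K C] [FiniteDimensional K C] :
    IsKronSum (⟨C, C, LinearMap.id, 0⟩ : Pair K) := by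
  refine ⟨Fin (Module.finrank K C), inferInstance, fun _ => Tz K 1,
    fun _ => Or.inr <| Or.inl ⟨1, le_rfl, Pair.Iso.refl _⟩, ?_⟩
  let e : C ≃ₗ[K] (Fin (Module.finrank K C) → Fin 1 → K) :=
    (Module.finBasis K C).equivFun.trans
      (LinearEquiv.piCongrRight fun _ => (LinearEquiv.funUnique (Fin 1) K K).symm)
  refine ⟨e, e, fun x => funext fun i => ?_, fun x => funext fun i => funext fun k => ?_⟩
  · change Matrix.toLin' 1 (e x i) = e x i
    rw [Matrix.toLin'_one, LinearMap.id_apply]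
  · change Matrix.toLin' _ (e x i) k = e 0 i k
    rw [Subsingleton.elim k 0, map_zero]
    exact toLin'_shift_zero (m := 0) _

theorem isKronSum_punit (D : Type) [AddCommGroup D] [Module K D] [FiniteDimensional K D] :
    IsKronSum (⟨PUnit, D, 0, 0⟩ : Pair K) := by
  refine ⟨Fin (Module.finrank K D), inferInstance, fun _ => Tn K 0,
    fun _ => Or.inr <| Or.inr <| Or.inl ⟨0, Pair.Iso.refl _⟩, ?_⟩
  let e : D ≃ₗ[K] (Fin (Module.finrank K D) → Fin 1 → K) :=
    (Module.finBasis K D).equivFun.trans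
      (LinearEquiv.piCongrRight fun _ => (LinearEquiv.funUnique (Fin 1) K K).symm)
  let f : PUnit ≃ₗ[K] (Fin (Module.finrank K D) → Fin 0 → K) := LinearEquiv.ofSubsingleton _ _
  have hf (x : PUnit) : f x = 0 := Subsingleton.elim _ _
  refine ⟨f, e, fun x => ?_, fun x => ?_⟩
  · change (dSum K _ fun _ => Tn K 0).mu (f x) = e 0
    rw [hf, map_zero]
    exact map_zero _
  · change (dSum K _ fun _ => Tn K 0).nu (f x) = e 0
    rw [hf, map_zero]
    exact map_zero _

/-- The restriction of a pair to the image of its second map. -/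
noncomputable def rangeRestrict (τ : Pair K) : Pair K :=
  ⟨(LinearMap.range τ.nu).comap τ.mu, LinearMap.range τ.nu, τ.mu.restrict fun _ h => h,
    τ.nu.rangeRestrict ∘ₗ Submodule.subtype _⟩

theorem exists_iso_cokerExt_rangeRestrict (τ : Pair K) :
    ∃ (C₀ C₁ : Submodule K τ.E) (D : Submodule K τ.V) (j : C₀ →ₗ[K] (rangeRestrict τ).V),
      IsCokernelLift (rangeRestrict τ) j ∧
      Pair.Iso K τ (dSum2 K (cokerExt (rangeRestrict τ) j)
        (dSum2 K ⟨C₁, C₁, LinearMap.id, 0⟩ ⟨PUnit, D, 0, 0⟩)) := by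
  set E₁ := (LinearMap.range τ.nu).comap τ.mu
  have mem_E₁ (x : τ.E) : x ∈ E₁ ↔ τ.mu x ∈ LinearMap.range τ.nu := Iff.rfl
  obtain ⟨W, hW⟩ := Submodule.exists_isCompl (LinearMap.ker τ.nu ⊓ E₁)
  set C₁ := LinearMap.ker τ.nu ⊓ W
  have hC₁E₁ : ∀ x ∈ C₁, x ∈ E₁ → x = 0 := fun x hx hx' =>
    (Submodule.disjoint_def.1 hW.disjoint) x ⟨hx.1, hx'⟩ hx.2
  have ker_le : LinearMap.ker τ.nu ≤ E₁ ⊔ C₁ := by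
    intro x hx
    obtain ⟨a, ha, w, hw, rfl⟩ := Submodule.mem_sup.1 (hW.sup_eq_top ▸ Submodule.mem_top : x ∈ _)
    exact Submodule.add_mem_sup ha.2 ⟨((Submodule.add_mem_iff_right _ ha.1).1 hx), hw⟩
  obtain ⟨C₀, hC₀⟩ := Submodule.exists_isCompl (E₁ ⊔ C₁)
  have hC₀' : ∀ x ∈ C₀, x ∈ E₁ ⊔ C₁ → x = 0 := fun x hx hx' =>
    (Submodule.disjoint_def.1 hC₀.disjoint) x hx' hx
  have decomp (x : τ.E) : ∃ c₀ ∈ C₀, ∃ e ∈ E₁, ∃ c₁ ∈ C₁, x = c₀ + e + c₁ := by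
    obtain ⟨y, hy, c₀, h₀, rfl⟩ :=
      Submodule.mem_sup.1 (hC₀.sup_eq_top ▸ Submodule.mem_top : x ∈ _)
    obtain ⟨e, he, c₁, h₁, rfl⟩ := Submodule.mem_sup.1 hy
    exact ⟨c₀, h₀, e, he, c₁, h₁, by abel⟩
  obtain ⟨D, hD⟩ := Submodule.exists_isCompl (LinearMap.range τ.nu ⊔ LinearMap.range τ.mu)
  let α : ((C₀ × E₁) × (C₁ × PUnit.{1})) →ₗ[K] τ.E :=
    (C₀.subtype.coprod E₁.subtype).coprod (C₁.subtype ∘ₗ LinearMap.fst K C₁ PUnit)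
  let β : ((C₀ × LinearMap.range τ.nu) × (C₁ × D)) →ₗ[K] τ.V :=
    ((τ.mu ∘ₗ C₀.subtype).coprod (Submodule.subtype _)).coprod
      ((τ.mu ∘ₗ C₁.subtype).coprod D.subtype)
  have hα : Function.Bijective α := by
    constructor
    · rw [injective_iff_map_eq_zero]
      rintro ⟨⟨⟨c₀, h₀⟩, ⟨e, he⟩⟩, ⟨⟨c₁, h₁⟩, u⟩⟩ h
      replace h : c₀ + e + c₁ = 0 := h
      have hc₀ : c₀ = 0 := hC₀' _ h₀ <| by
        rw [show c₀ = -(e + c₁) by rw [eq_neg_iff_add_eq_zero, ← h]; abel]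
        exact neg_mem (Submodule.add_mem_sup he h₁)
      subst hc₀
      have hc₁ : c₁ = 0 := hC₁E₁ _ h₁ <| by
        rw [show c₁ = -e by rw [eq_neg_iff_add_eq_zero, ← h]; abel]
        exact neg_mem he
      subst hc₁
      have he0 : e = 0 := by simpa using h
      subst he0
      rfl
    · intro x
      obtain ⟨c₀, h₀, e, he, c₁, h₁, rfl⟩ := decomp x
      exact ⟨((⟨c₀, h₀⟩, ⟨e, he⟩), (⟨c₁, h₁⟩, 0)), rfl⟩
  have hβ : Function.Bijective β := by
    constructor
    · rw [injective_iff_map_eq_zero]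
      rintro ⟨⟨⟨c₀, h₀⟩, ⟨v, hv⟩⟩, ⟨⟨c₁, h₁⟩, ⟨d, hd⟩⟩⟩ h
      replace h : τ.mu c₀ + v + (τ.mu c₁ + d) = 0 := h
      have hd0 : d = 0 := (Submodule.disjoint_def.1 hD.disjoint) d (by
        rw [show d = -(v + τ.mu (c₀ + c₁)) by
          rw [eq_neg_iff_add_eq_zero, ← h, map_add]; abel]
        exact neg_mem (Submodule.add_mem_sup hv ⟨_, rfl⟩)) hd
      subst hd0
      have hc : c₀ + c₁ ∈ E₁ := by
        rw [mem_E₁, show τ.mu (c₀ + c₁) = -v by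
          rw [eq_neg_iff_add_eq_zero, ← h, map_add]; abel]
        exact neg_mem hv
      have hc₀ : c₀ = 0 := hC₀' _ h₀ <| by
        rw [show c₀ = (c₀ + c₁) + -c₁ by abel]
        exact Submodule.add_mem_sup hc (neg_mem h₁)
      subst hc₀
      have hc₁ : c₁ = 0 := hC₁E₁ _ h₁ (by simpa using hc)
      subst hc₁
      have hv0 : v = 0 := by simpa using h
      subst hv0
      rfl
    · intro y
      obtain ⟨z, hz, d, hd, rfl⟩ :=
        Submodule.mem_sup.1 (hD.sup_eq_top ▸ Submodule.mem_top : y ∈ _)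
      obtain ⟨v, hv, _, ⟨x, rfl⟩, rfl⟩ := Submodule.mem_sup.1 hz
      obtain ⟨c₀, h₀, e, he, c₁, h₁, rfl⟩ := decomp x
      refine ⟨((⟨c₀, h₀⟩, ⟨v + τ.mu e, add_mem hv he⟩), (⟨c₁, h₁⟩, ⟨d, hd⟩)), ?_⟩
      change τ.mu c₀ + (v + τ.mu e) + (τ.mu c₁ + d) = _
      rw [map_add, map_add]
      abel
  refine ⟨C₀, C₁, D, τ.nu.rangeRestrict ∘ₗ C₀.subtype, ⟨?_, ?_⟩,
    Pair.Iso.symm ⟨LinearEquiv.ofBijective α hα, LinearEquiv.ofBijective β hβ, ?_, ?_⟩⟩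
  · rintro ⟨c, hc⟩ ⟨e, he⟩ h
    have h' : τ.nu c + τ.nu e = 0 := congrArg Subtype.val h
    refine Subtype.ext (hC₀' c hc ?_)
    rw [show c = (c + e) + -e by abel]
    refine add_mem (ker_le ?_) (neg_mem (Submodule.mem_sup_left he))
    rw [LinearMap.mem_ker, map_add, h']
  · rintro ⟨_, x, rfl⟩
    obtain ⟨c₀, h₀, e, he, c₁, h₁, rfl⟩ := decomp x
    refine ⟨⟨c₀, h₀⟩, ⟨e, he⟩, Subtype.ext ?_⟩
    change τ.nu c₀ + τ.nu e = τ.nu (c₀ + e + c₁)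
    rw [map_add, map_add, LinearMap.mem_ker.1 h₁.1, add_zero]
  · rintro ⟨⟨⟨c₀, h₀⟩, ⟨e, he⟩⟩, ⟨⟨c₁, h₁⟩, u⟩⟩
    change τ.mu (c₀ + e + c₁) = τ.mu c₀ + τ.mu e + (τ.mu c₁ + 0)
    rw [map_add, map_add, add_zero]
  · rintro ⟨⟨⟨c₀, h₀⟩, ⟨e, he⟩⟩, ⟨⟨c₁, h₁⟩, u⟩⟩
    change τ.nu (c₀ + e + c₁) = τ.mu 0 + (τ.nu c₀ + τ.nu e) + (τ.mu 0 + 0)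
    rw [map_add, map_add, LinearMap.mem_ker.1 h₁.1, map_zero]
    abel

theorem IsKronSum.of_rangeRestrict {τ : Pair K} (h : IsKronSum (rangeRestrict τ)) :
    IsKronSum τ := by
  obtain ⟨C₀, C₁, D, j, hj, e⟩ := exists_iso_cokerExt_rangeRestrict τ
  exact ((h.cokerExt hj).dSum2 ((isKronSum_id_zero C₁).dSum2 (isKronSum_punit D))).of_iso e

/-! ### Duality -/

/-- The pair of transposed maps. -/
noncomputable def dual (τ : Pair K) : Pair K :=
  ⟨Module.Dual K τ.V, Module.Dual K τ.E, τ.mu.dualMap, τ.nu.dualMap⟩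

theorem iso_dual_dual (τ : Pair K) : Pair.Iso K τ (dual (dual τ)) :=
  ⟨Module.evalEquiv K τ.E, Module.evalEquiv K τ.V, fun _ => rfl, fun _ => rfl⟩

theorem Pair.Iso.dual {τ σ : Pair K} (h : Pair.Iso K τ σ) : Pair.Iso K (dual τ) (dual σ) := by
  obtain ⟨α, β, hμ, hν⟩ := h
  exact Pair.Iso.symm ⟨β.dualMap, α.dualMap,
    fun (f : Module.Dual K σ.V) => LinearMap.ext fun x => congrArg f (hμ x).symm,
    fun (f : Module.Dual K σ.V) => LinearMap.ext fun x => congrArg f (hν x).symm⟩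

theorem dual_dSum {ι : Type} [Finite ι] (σ : ι → Pair K) :
    Pair.Iso K (dual (dSum K ι σ)) (dSum K ι fun i => dual (σ i)) := by
  classical
  have := Fintype.ofFinite ι
  refine Pair.Iso.symm ⟨LinearMap.lsum K (fun i => (σ i).V) K,
    LinearMap.lsum K (fun i => (σ i).E) K,
    fun (f : ∀ i, Module.Dual K (σ i).V) => LinearMap.ext fun (x : ∀ i, (σ i).E) => ?_,
    fun (f : ∀ i, Module.Dual K (σ i).V) => LinearMap.ext fun (x : ∀ i, (σ i).E) => ?_⟩
  · change LinearMap.lsum K (fun i => (σ i).V) K f (fun i => (σ i).mu (x i)) =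
      LinearMap.lsum K (fun i => (σ i).E) K (fun i => f i ∘ₗ (σ i).mu) x
    rw [LinearMap.lsum_apply, LinearMap.lsum_apply, LinearMap.sum_apply, LinearMap.sum_apply]
    rfl
  · change LinearMap.lsum K (fun i => (σ i).V) K f (fun i => (σ i).nu (x i)) =
      LinearMap.lsum K (fun i => (σ i).E) K (fun i => f i ∘ₗ (σ i).nu) x
    rw [LinearMap.lsum_apply, LinearMap.lsum_apply, LinearMap.sum_apply, LinearMap.sum_apply]
    rfl

theorem dual_ofMats {a b : ℕ} (M N : Matrix (Fin b) (Fin a) K) :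
    Pair.Iso K (dual (ofMats K M N)) (ofMats K M.transpose N.transpose) := by
  refine Pair.Iso.symm ⟨dotProductEquiv K (Fin b), dotProductEquiv K (Fin a),
    fun (x : Fin b → K) => LinearMap.ext fun (y : Fin a → K) => ?_,
    fun (x : Fin b → K) => LinearMap.ext fun (y : Fin a → K) => ?_⟩
  · change dotProduct x (M.mulVec y) = dotProduct (M.transpose.mulVec x) y
    rw [Matrix.dotProduct_mulVec, Matrix.mulVec_transpose]
  · change dotProduct x (N.mulVec y) = dotProduct (N.transpose.mulVec x) y
    rw [Matrix.dotProduct_mulVec, Matrix.mulVec_transpose]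

theorem ofMats_submatrix {a b : ℕ} (M N : Matrix (Fin b) (Fin a) K) (f : Equiv.Perm (Fin b))
    (e : Equiv.Perm (Fin a)) :
    Pair.Iso K (ofMats K M N) (ofMats K (M.submatrix f e) (N.submatrix f e)) := by
  refine ⟨LinearEquiv.funCongrLeft K K e, LinearEquiv.funCongrLeft K K f,
    fun (x : Fin a → K) => ?_, fun (x : Fin a → K) => ?_⟩
  · change (M.submatrix f e).mulVec (x ∘ e) = M.mulVec x ∘ f
    rw [Matrix.submatrix_mulVec_equiv, Function.comp_assoc, e.self_comp_symm, Function.comp_id]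
  · change (N.submatrix f e).mulVec (x ∘ e) = N.mulVec x ∘ f
    rw [Matrix.submatrix_mulVec_equiv, Function.comp_assoc, e.self_comp_symm, Function.comp_id]

theorem dual_Tz (n : ℕ) : Pair.Iso K (dual (Tz K n)) (Tz K n) := by
  refine (dual_ofMats _ _).trans ((ofMats_submatrix _ _ Fin.revPerm Fin.revPerm).trans ?_)
  unfold Tz
  convert Pair.Iso.refl (K := K) _ using 2
  · simp
  · ext i j
    simp only [Matrix.of_apply, Matrix.submatrix_apply, Matrix.transpose_apply, Fin.revPerm_apply,
      Fin.val_rev]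
    congr 1
    apply propext
    omega

theorem dual_Tn (n : ℕ) : Pair.Iso K (dual (Tn K n)) (zTz K n) := by
  refine (dual_ofMats _ _).trans ?_
  unfold zTz
  convert Pair.Iso.refl (K := K) _ using 2
  · ext i j
    simp [eq_comm]
  · ext i j
    simp [eq_comm]

theorem dual_zTz (n : ℕ) : Pair.Iso K (dual (zTz K n)) (Tn K n) :=
  (dual_Tn n).symm.dual.trans (iso_dual_dual _).symm

theorem isKronSum_dual_of_bijective_nu {τ : Pair K} (h : Function.Bijective τ.nu) :
    IsKronSum (dual τ) :=
  isKronSum_of_bijective_nu (LinearEquiv.ofBijective τ.nu h).dualMap.bijective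

theorem IsKron.dual {τ : Pair K} (h : IsKron K τ) : IsKronSum (dual τ) := by
  rcases h with ⟨n, -, h⟩ | ⟨n, hn, h⟩ | ⟨n, h⟩ | ⟨n, h⟩ | ⟨p, n, -, -, -, -, h0, h⟩ <;>
    refine IsKronSum.of_iso ?_ h.dual
  · exact isKronSum_dual_of_bijective_nu (zT_nu_bijective n)
  · exact IsKron.isKronSum <| Or.inr <| Or.inl ⟨n, hn, dual_Tz n⟩
  · exact IsKron.isKronSum <| Or.inr <| Or.inr <| Or.inr <| Or.inl ⟨n, dual_Tn n⟩
  · exact IsKron.isKronSum <| Or.inr <| Or.inr <| Or.inl ⟨n, dual_zTz n⟩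
  · exact isKronSum_dual_of_bijective_nu Function.bijective_id

theorem IsKronSum.dual {τ : Pair K} (h : IsKronSum τ) : IsKronSum (dual τ) := by
  obtain ⟨ι, _, σ, hσ, e⟩ := h
  exact (IsKronSum.dSum fun i => (hσ i).dual).of_iso (e.dual.trans (dual_dSum σ))

theorem finrank_rangeRestrict_lt {τ : Pair K} (h : ¬ Function.Surjective τ.nu) :
    Module.finrank K (rangeRestrict τ).E + Module.finrank K (rangeRestrict τ).V <
      Module.finrank K τ.E + Module.finrank K τ.V :=
  add_lt_add_of_le_of_lt (Submodule.finrank_le _)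
    (Submodule.finrank_lt fun h' => h (LinearMap.range_eq_top.1 h'))

theorem isKronSum (τ : Pair K) : IsKronSum τ := by
  induction hn : Module.finrank K τ.E + Module.finrank K τ.V using Nat.strong_induction_on
    generalizing τ with
  | _ n ih =>
    subst hn
    by_cases hs : Function.Surjective τ.nu
    · by_cases hi : Function.Injective τ.nu
      · exact isKronSum_of_bijective_nu ⟨hi, hs⟩
      · refine IsKronSum.of_iso (IsKronSum.dual (.of_rangeRestrict (ih _ ?_ _ rfl)))
          (iso_dual_dual τ)
        refine (finrank_rangeRestrict_lt fun h => hi ?_).trans_eq ?_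
        · exact LinearMap.dualMap_surjective_iff.1 h
        · change Module.finrank K (Module.Dual K τ.V) + Module.finrank K (Module.Dual K τ.E) = _
          rw [Subspace.dual_finrank_eq, Subspace.dual_finrank_eq, add_comm]
    · exact .of_rangeRestrict (ih _ (finrank_rangeRestrict_lt hs) _ rfl)

end KroneckerClassification

/-- Every transformation-pair over `K` is isomorphic to a finite
direct sum of members of Kronecker's list `L(K)`. -/
theorem stmt16 (K : Type) [Field K] (τ : Pair K) :
    ∃ (k : ℕ) (σ : Fin k → Pair K), (∀ i, IsKron K (σ i)) ∧
      Pair.Iso K τ (dSum K (Fin k) σ) := by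
  obtain ⟨ι, _, σ, hσ, e⟩ := isKronSum τ
  obtain ⟨k, ⟨f⟩⟩ := Finite.exists_equiv_fin ι
  exact ⟨k, fun i => σ (f.symm i), fun i => hσ _, e.trans (dSum_reindex f.symm σ).symm⟩

end Towber
end
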